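/- Let p ∈ (1,∞) and let R = ∏_{i=1}^n (a_i,b_i) with −∞ < a_i < b_i < ∞. Then the norm of the canonical embedding W_0^{1,p}(R) ↪ L^p(R), namely sup{‖u‖_{L^p(R)}/‖u‖_{W^{1,p}(R)} : u ∈ W_0^{1,p}(R), u ≠ 0}, is attained by the function u(x) = ∏_{i=1}^n sin_p(π_p (x_i − a_i)/(b_i − a_i)), x ∈ R. Moreover, u is the unique positive maximizer up to a positive multiplicative constant. -/

import Mathlib

open MeasureTheory ENNReal Set Filter Topology

noncomputable section

/-- The `i`-th partial derivative of `u : ℝⁿ → ℝ`. -/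
def pder {n : ℕ} (i : Fin n) (u : (Fin n → ℝ) → ℝ) (x : Fin n → ℝ) : ℝ :=
  fderiv ℝ u x (Pi.single i 1)

/-- `u` is a smooth function compactly supported in the open set `D`. -/
def IsTestFun {n : ℕ} (D : Set (Fin n → ℝ)) (u : (Fin n → ℝ) → ℝ) : Prop :=
  ContDiff ℝ (⊤ : ℕ∞) u ∧ HasCompactSupport u ∧ tsupport u ⊆ D

/-- The strip-like domain `ℝᵏ × ∏_{i ≥ k} (aᵢ, bᵢ)`, realized as a subset of `ℝⁿ`:
the coordinates `i < k` are free, the coordinates `i ≥ k` are constrained to `(aᵢ, bᵢ)`. -/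
def stripDomain (n k : ℕ) (a b : Fin n → ℝ) : Set (Fin n → ℝ) :=
  {x | ∀ i : Fin n, k ≤ (i : ℕ) → x i ∈ Set.Ioo (a i) (b i)}

/-- The ambient space `V = L^p(ℝⁿ; ℓ^p(ℝ^{n+1}))`, in which the Sobolev space `W^{1,p}_0`
is realized as the closure of the set of "jets" `(u, ∇u)` of test functions. -/
abbrev Vsp (n : ℕ) (p : ℝ≥0∞) [Fact (1 ≤ p)] :=
  Lp (PiLp p (fun _ : Fin (n + 1) => ℝ)) p (volume : Measure (Fin n → ℝ))

/-- The "jet" `(u, ∂₁u, …, ∂ₙu)` of a function, valued in `ℓ^p(ℝ^{n+1})`. -/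
def jet {n : ℕ} (p : ℝ≥0∞) (u : (Fin n → ℝ) → ℝ) (x : Fin n → ℝ) :
    PiLp p (fun _ : Fin (n + 1) => ℝ) :=
  (WithLp.equiv p (∀ _ : Fin (n + 1), ℝ)).symm (Fin.cons (u x) (fun i => pder i u x))

/-- `W^{1,p}_0(D)` realized as a closed subspace of `V`:
the closure of the subspace of jets of test functions supported in `D`.
The (subspace) norm of the jet of `u` is exactly
`(‖u‖_p^p + ‖ |∇u|_{ℓ^p} ‖_p^p)^{1/p}`, i.e., the `W^{1,p}`-norm of `u`. -/
def W0sub {n : ℕ} (p : ℝ≥0∞) [Fact (1 ≤ p)] (D : Set (Fin n → ℝ)) : Submodule ℝ (Vsp n p) :=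
  (Submodule.span ℝ {f : Vsp n p | ∃ u : (Fin n → ℝ) → ℝ, IsTestFun D u ∧
    (f : (Fin n → ℝ) → PiLp p (fun _ : Fin (n + 1) => ℝ)) =ᵐ[volume] jet p u}).topologicalClosure

instance W0sub.completeSpace {n : ℕ} (p : ℝ≥0∞) [Fact (1 ≤ p)] (D : Set (Fin n → ℝ)) :
    CompleteSpace (W0sub (n := n) p D) :=
  (Submodule.isClosed_topologicalClosure _).completeSpace_coe

/-- Projection of a jet onto its zeroth (function) component. -/
def proj0 (n : ℕ) (p : ℝ≥0∞) [Fact (1 ≤ p)] : PiLp p (fun _ : Fin (n + 1) => ℝ) →L[ℝ] ℝ :=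
  (ContinuousLinearMap.proj (0 : Fin (n + 1))).comp
    (PiLp.continuousLinearEquiv p ℝ (fun _ : Fin (n + 1) => ℝ)).toContinuousLinearMap

/-- Projection of a jet onto its gradient components, valued in `ℓ^p(ℝⁿ)`. -/
def projGrad (n : ℕ) (p : ℝ≥0∞) [Fact (1 ≤ p)] :
    PiLp p (fun _ : Fin (n + 1) => ℝ) →L[ℝ] PiLp p (fun _ : Fin n => ℝ) :=
  ((PiLp.continuousLinearEquiv p ℝ (fun _ : Fin n => ℝ)).symm.toContinuousLinearMap).comp
    ((ContinuousLinearMap.pi fun i : Fin n => ContinuousLinearMap.proj (R := ℝ) i.succ).comp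
      (PiLp.continuousLinearEquiv p ℝ (fun _ : Fin (n + 1) => ℝ)).toContinuousLinearMap)

/-- The canonical Sobolev embedding `I : W^{1,p}_0(D) → L^p(D)` (as a map into `L^p(ℝⁿ)`;
all functions in `W^{1,p}_0(D)` vanish a.e. outside `D`). -/
def SobolevEmb {n : ℕ} (p : ℝ≥0∞) [Fact (1 ≤ p)] (D : Set (Fin n → ℝ)) :
    W0sub (n := n) p D →L[ℝ] Lp ℝ p (volume : Measure (Fin n → ℝ)) :=
  ((proj0 n p).compLpL p volume).comp (W0sub p D).subtypeL

/-- The gradient map `W^{1,p}_0(D) → L^p(D; ℓ^p(ℝⁿ))`, `u ↦ ∇u`. -/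
def SobolevGrad {n : ℕ} (p : ℝ≥0∞) [Fact (1 ≤ p)] (D : Set (Fin n → ℝ)) :
    W0sub (n := n) p D →L[ℝ] Lp (PiLp p (fun _ : Fin n => ℝ)) p (volume : Measure (Fin n → ℝ)) :=
  ((projGrad n p).compLpL p volume).comp (W0sub p D).subtypeL

/-- `π_p = 2 ∫₀¹ (1 - sᵖ)^{-1/p} ds`. -/
def piP (p : ℝ) : ℝ := 2 * ∫ s in (0 : ℝ)..1, (1 - s ^ p) ^ (-1 / p)

/-- The inverse of `t ↦ ∫₀ᵗ (1 - sᵖ)^{-1/p} ds` on `[0,1]`; this is `sin_p` on `[0, π_p/2]`. -/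
def sinpHalf (p : ℝ) : ℝ → ℝ :=
  Function.invFunOn (fun t : ℝ => ∫ s in (0 : ℝ)..t, (1 - s ^ p) ^ (-1 / p)) (Set.Icc 0 1)

/-- `sin_p` on `[0, π_p]`, by reflection around `π_p/2`. -/
def sinpBase (p t : ℝ) : ℝ :=
  if t ≤ piP p / 2 then sinpHalf p t else sinpHalf p (piP p - t)

/-- `sin_p` on `[-π_p, π_p]`, by odd reflection. -/
def sinpSym (p t : ℝ) : ℝ := if 0 ≤ t then sinpBase p t else -sinpBase p (-t)

/-- The generalized sine function `sin_p`, extended `2π_p`-periodically to all of `ℝ`. -/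
def sinp (p t : ℝ) : ℝ :=
  sinpSym p (t - 2 * piP p * ⌊(t + piP p) / (2 * piP p)⌋)

/-- The generalized cosine function `cos_p = (sin_p)'`. -/
def cosp (p : ℝ) : ℝ → ℝ := deriv (sinp p)

/-- The `m`-th entropy number of a bounded linear operator: the infimum of all `ε > 0` such
that the image of the closed unit ball can be covered by `2^{m-1}` balls of radius `ε`. -/
def entropyNumber {X Y : Type*} [NormedAddCommGroup X] [NormedSpace ℝ X]
    [NormedAddCommGroup Y] [NormedSpace ℝ Y] (m : ℕ) (T : X →L[ℝ] Y) : ℝ :=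
  sInf {ε : ℝ | 0 < ε ∧ ∃ c : Fin (2 ^ (m - 1)) → Y,
    ∀ x : X, ‖x‖ ≤ 1 → ∃ j, ‖T x - c j‖ ≤ ε}

end

/-- The odd power function `x ↦ |x|^{p-2} x`. -/
noncomputable def oddPow (p x : ℝ) : ℝ := |x| ^ (p - 2) * x

theorem oddPow_of_pos {p x : ℝ} (hx : 0 < x) : oddPow p x = x ^ (p - 1) := by
  rw [oddPow, abs_of_pos hx]
  nth_rw 2 [← Real.rpow_one x]
  rw [← Real.rpow_add hx]; ring_nf

theorem oddPow_neg (p x : ℝ) : oddPow p (-x) = -oddPow p x := by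
  simp [oddPow]

theorem oddPow_zero (p : ℝ) : oddPow p 0 = 0 := by simp [oddPow]

theorem oddPow_of_nonneg {p x : ℝ} (hp : 1 < p) (hx : 0 ≤ x) : oddPow p x = x ^ (p - 1) := by
  rcases hx.eq_or_lt with rfl | hx
  · rw [oddPow_zero, Real.zero_rpow (by linarith)]
  · exact oddPow_of_pos hx

theorem oddPow_mul_self {p : ℝ} (hp : 1 < p) (x : ℝ) : oddPow p x * x = |x| ^ p := by
  wlog hx : 0 ≤ x generalizing x
  · have := this (-x) (by linarith)
    rw [oddPow_neg, abs_neg] at this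
    linarith
  rw [oddPow_of_nonneg hp hx, abs_of_nonneg hx]
  rcases hx.eq_or_lt with rfl | hx
  · rw [Real.zero_rpow (by linarith : p ≠ 0)]; simp
  · nth_rw 2 [← Real.rpow_one x]
    rw [← Real.rpow_add hx]; ring_nf

theorem hasDerivAt_abs_rpow_oddPow {p : ℝ} (hp : 1 < p) (x : ℝ) :
    HasDerivAt (fun x : ℝ => |x| ^ p) (p * oddPow p x) x := by
  simpa [oddPow, mul_assoc] using hasDerivAt_abs_rpow x hp

theorem contDiff_abs_rpow {p : ℝ} (hp : 1 < p) : ContDiff ℝ 1 (fun x : ℝ => |x| ^ p) := by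
  simpa [Real.norm_eq_abs] using contDiff_norm_rpow (E := ℝ) hp

theorem continuous_oddPow {p : ℝ} (hp : 1 < p) : Continuous (oddPow p) := by
  have h := (contDiff_abs_rpow hp).continuous_deriv le_rfl
  have h2 : oddPow p = fun x => p⁻¹ * deriv (fun x : ℝ => |x| ^ p) x := by
    ext x
    rw [(hasDerivAt_abs_rpow_oddPow hp x).deriv]
    field_simp
  rw [h2]
  fun_prop

theorem oddPow_div {p x y : ℝ} (hy : 0 < y) : oddPow p (x / y) = oddPow p x / y ^ (p - 1) := by
  simp only [oddPow, abs_div, abs_of_pos hy]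
  rw [Real.div_rpow (abs_nonneg _) hy.le]
  have : y ^ (p - 1) = y ^ (p - 2) * y := by
    nth_rw 3 [← Real.rpow_one y]
    rw [← Real.rpow_add hy]; ring_nf
  rw [this]
  field_simp

theorem oddPow_mul {p x y : ℝ} (hy : 0 < y) : oddPow p (y * x) = y ^ (p - 1) * oddPow p x := by
  simp only [oddPow, abs_mul, abs_of_pos hy]
  rw [Real.mul_rpow hy.le (abs_nonneg _)]
  have : y ^ (p - 1) = y ^ (p - 2) * y := by
    nth_rw 3 [← Real.rpow_one y]
    rw [← Real.rpow_add hy]; ring_nf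
  rw [this]
  ring

theorem intervalIntegrable_sinp_integrand {p : ℝ} (hp : 1 < p) {s t : ℝ}
    (hs : s ∈ Icc (0 : ℝ) 1) (ht : t ∈ Icc (0 : ℝ) 1) :
    IntervalIntegrable (fun s : ℝ => (1 - s ^ p) ^ (-1 / p)) volume s t := by
  have h1 : IntervalIntegrable (fun s : ℝ => (1 - s ^ p) ^ (-1 / p)) volume 0 1 := by
    have h0 : IntervalIntegrable (fun s : ℝ => (1 - s) ^ (-1 / p)) volume 0 1 := by
      have hq : -1 < -1 / p := by
        rw [lt_div_iff₀ (by linarith)]; linarith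
      have := (intervalIntegral.intervalIntegrable_rpow' (a := 0) (b := 1) hq).comp_sub_left 1
      simpa using this.symm
    refine h0.mono_fun ?_ ?_
    · exact Measurable.aestronglyMeasurable (by fun_prop)
    · have : ∀ᵐ x : ℝ ∂(volume.restrict (uIoc 0 1)), x ≠ 1 := by
        refine ae_restrict_of_ae ?_
        simp [ae_iff]
      filter_upwards [this, ae_restrict_mem measurableSet_uIoc] with x hx1 hx
      rw [uIoc_of_le zero_le_one] at hx
      have hxlt : x < 1 := lt_of_le_of_ne hx.2 hx1
      have h2 : x ^ p ≤ x := by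
        calc x ^ p ≤ x ^ (1 : ℝ) := Real.rpow_le_rpow_of_exponent_ge hx.1 hx.2 hp.le
          _ = x := Real.rpow_one x
      rw [Real.norm_of_nonneg (Real.rpow_nonneg (by linarith) _),
        Real.norm_of_nonneg (Real.rpow_nonneg (by linarith) _)]
      refine Real.rpow_le_rpow_of_nonpos (by linarith) (by linarith) ?_
      exact div_nonpos_of_nonpos_of_nonneg (by norm_num) (by linarith)
  refine h1.mono_set ?_
  rw [uIcc_of_le zero_le_one]
  exact (convex_Icc (0:ℝ) 1).ordConnected.uIcc_subset hs ht

/-- The inverse function of `sin_p` on `[0, 1]`. -/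
noncomputable def arcsinp (p t : ℝ) : ℝ := ∫ s in (0 : ℝ)..t, (1 - s ^ p) ^ (-1 / p)

theorem arcsinp_zero (p : ℝ) : arcsinp p 0 = 0 := by simp [arcsinp]

theorem arcsinp_one (p : ℝ) : arcsinp p 1 = piP p / 2 := by simp [arcsinp, piP]

theorem sub_le_arcsinp_sub {p : ℝ} (hp : 1 < p) {s t : ℝ} (hs : s ∈ Icc (0 : ℝ) 1)
    (ht : t ∈ Icc (0 : ℝ) 1) (hst : s ≤ t) : t - s ≤ arcsinp p t - arcsinp p s := by
  have h0 : (0:ℝ) ∈ Icc (0:ℝ) 1 := by simp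
  rw [arcsinp, arcsinp, intervalIntegral.integral_interval_sub_left
    (intervalIntegrable_sinp_integrand hp h0 ht) (intervalIntegrable_sinp_integrand hp h0 hs)]
  have h1 : t - s = ∫ _ in s..t, (1:ℝ) := by simp
  rw [h1]
  refine intervalIntegral.integral_mono_on_of_le_Ioo hst (by simp)
    (intervalIntegrable_sinp_integrand hp hs ht) ?_
  intro x hx
  have hx0 : 0 < x := hs.1.trans_lt hx.1
  have hx1 : x < 1 := hx.2.trans_le ht.2
  have h2 : x ^ p < 1 := Real.rpow_lt_one hx0.le hx1 (by linarith)
  have h3 : 0 ≤ x ^ p := Real.rpow_nonneg hx0.le _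
  exact Real.one_le_rpow_of_pos_of_le_one_of_nonpos (by linarith) (by linarith)
    (div_nonpos_of_nonpos_of_nonneg (by norm_num) (by linarith))

theorem continuousOn_arcsinp {p : ℝ} (hp : 1 < p) : ContinuousOn (arcsinp p) (Icc 0 1) := by
  have := intervalIntegral.continuousOn_primitive_interval (μ := volume)
    (f := fun s : ℝ => (1 - s ^ p) ^ (-1 / p)) (a := 0) (b := 1) ?_
  · rwa [uIcc_of_le zero_le_one] at this
  · rw [uIcc_of_le zero_le_one, ← intervalIntegrable_iff_integrableOn_Icc_of_le zero_le_one]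
    exact intervalIntegrable_sinp_integrand hp (by simp) (by simp)

theorem hasDerivAt_arcsinp {p : ℝ} (hp : 1 < p) {t : ℝ} (ht : t ∈ Ioo (0 : ℝ) 1) :
    HasDerivAt (arcsinp p) ((1 - t ^ p) ^ (-1 / p)) t := by
  refine intervalIntegral.integral_hasDerivAt_right
    (intervalIntegrable_sinp_integrand hp (by simp) ⟨ht.1.le, ht.2.le⟩) ?_ ?_
  · exact (Measurable.stronglyMeasurable (by fun_prop)).stronglyMeasurableAtFilter
  · have h2 : t ^ p < 1 := Real.rpow_lt_one ht.1.le ht.2 (by linarith)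
    refine ContinuousAt.rpow_const ?_ (Or.inl (by linarith))
    exact continuousAt_const.sub (Real.continuousAt_rpow_const _ _ (Or.inl ht.1.ne'))

theorem sinpHalf_spec {p : ℝ} (hp : 1 < p) {t : ℝ} (ht : t ∈ Icc 0 (piP p / 2)) :
    sinpHalf p t ∈ Icc (0 : ℝ) 1 ∧ arcsinp p (sinpHalf p t) = t := by
  have h := intermediate_value_Icc zero_le_one (continuousOn_arcsinp hp)
  rw [arcsinp_zero, arcsinp_one] at h
  exact ⟨Function.invFunOn_mem (h ht), Function.invFunOn_eq (h ht)⟩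

theorem piP_pos {p : ℝ} (hp : 1 < p) : 0 < piP p := by
  have := sub_le_arcsinp_sub hp (s := 0) (t := 1) (by simp) (by simp) zero_le_one
  rw [arcsinp_zero, arcsinp_one] at this
  linarith

theorem strictMonoOn_arcsinp {p : ℝ} (hp : 1 < p) : StrictMonoOn (arcsinp p) (Icc 0 1) := by
  intro s hs t ht hst
  have := sub_le_arcsinp_sub hp hs ht hst.le
  linarith

theorem sinpHalf_arcsinp {p : ℝ} (hp : 1 < p) {s : ℝ} (hs : s ∈ Icc (0 : ℝ) 1) :
    sinpHalf p (arcsinp p s) = s :=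
  (strictMonoOn_arcsinp hp).injOn.leftInvOn_invFunOn hs

theorem abs_sinpHalf_sub_le {p : ℝ} (hp : 1 < p) {s t : ℝ} (hs : s ∈ Icc 0 (piP p / 2))
    (ht : t ∈ Icc 0 (piP p / 2)) : |sinpHalf p s - sinpHalf p t| ≤ |s - t| := by
  wlog h : sinpHalf p t ≤ sinpHalf p s generalizing s t
  · rw [abs_sub_comm, abs_sub_comm s]
    exact this ht hs (by linarith)
  have h1 := sinpHalf_spec hp hs
  have h2 := sinpHalf_spec hp ht
  have h3 := sub_le_arcsinp_sub hp h2.1 h1.1 h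
  rw [h1.2, h2.2] at h3
  rw [abs_of_nonneg (by linarith)]
  exact h3.trans (le_abs_self _)

theorem continuousOn_sinpHalf {p : ℝ} (hp : 1 < p) :
    ContinuousOn (sinpHalf p) (Icc 0 (piP p / 2)) := by
  have : LipschitzOnWith 1 (sinpHalf p) (Icc 0 (piP p / 2)) :=
    LipschitzOnWith.of_dist_le_mul fun x hx y hy => by
      simpa [Real.dist_eq] using abs_sinpHalf_sub_le hp hx hy
  exact this.continuousOn

theorem sinpHalf_zero {p : ℝ} (hp : 1 < p) : sinpHalf p 0 = 0 := by
  simpa [arcsinp_zero] using sinpHalf_arcsinp hp (s := 0) (by simp)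

theorem sinpHalf_pi_div_two {p : ℝ} (hp : 1 < p) : sinpHalf p (piP p / 2) = 1 := by
  simpa [arcsinp_one] using sinpHalf_arcsinp hp (s := 1) (by simp)

theorem sinpHalf_pos {p : ℝ} (hp : 1 < p) {t : ℝ} (ht : t ∈ Ioc 0 (piP p / 2)) :
    0 < sinpHalf p t := by
  have h := sinpHalf_spec hp (Ioc_subset_Icc_self ht)
  refine lt_of_le_of_ne h.1.1 fun h0 => ?_
  rw [← h0, arcsinp_zero] at h
  exact ht.1.ne h.2

theorem sinpHalf_lt_one {p : ℝ} (hp : 1 < p) {t : ℝ} (ht : t ∈ Ico 0 (piP p / 2)) :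
    sinpHalf p t < 1 := by
  have h := sinpHalf_spec hp (Ico_subset_Icc_self ht)
  refine lt_of_le_of_ne h.1.2 fun h0 => ?_
  rw [h0, arcsinp_one] at h
  exact ht.2.ne h.2.symm

theorem hasDerivAt_sinpHalf {p : ℝ} (hp : 1 < p) {t : ℝ} (ht : t ∈ Ioo 0 (piP p / 2)) :
    HasDerivAt (sinpHalf p) ((1 - sinpHalf p t ^ p) ^ (1 / p)) t := by
  have h0 := sinpHalf_pos hp (Ioo_subset_Ioc_self ht)
  have h1 := sinpHalf_lt_one hp (Ioo_subset_Ico_self ht)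
  have h2 : sinpHalf p t ^ p < 1 := Real.rpow_lt_one h0.le h1 (by linarith)
  have hnhds : Icc 0 (piP p / 2) ∈ 𝓝 t := Icc_mem_nhds ht.1 ht.2
  have := HasDerivAt.of_local_left_inverse ((continuousOn_sinpHalf hp).continuousAt hnhds)
    (hasDerivAt_arcsinp hp ⟨h0, h1⟩) (Real.rpow_pos_of_pos (by linarith) _).ne' (by
      filter_upwards [hnhds] with y hy using (sinpHalf_spec hp hy).2)
  rwa [← Real.rpow_neg (by linarith), neg_div, neg_neg] at this

/-- The half wave of `sin_p` on `[0, π_p]`, extended by zero. -/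
noncomputable def sinpWave (p t : ℝ) : ℝ := sinpHalf p (max 0 (min t (piP p - t)))

/-- The derivative of `sinpWave p` on `(0, π_p)`. -/
noncomputable def cospWave (p t : ℝ) : ℝ :=
  if t ≤ piP p / 2 then (1 - sinpWave p t ^ p) ^ (1 / p) else -(1 - sinpWave p t ^ p) ^ (1 / p)

theorem fold_mem {p : ℝ} (hp : 1 < p) (t : ℝ) :
    max 0 (min t (piP p - t)) ∈ Icc 0 (piP p / 2) := by
  have := piP_pos hp
  refine ⟨le_max_left _ _, max_le (by linarith) ?_⟩
  rcases le_total t (piP p / 2) with h | h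
  · exact (min_le_left _ _).trans h
  · exact (min_le_right _ _).trans (by linarith)

theorem sinpWave_mem {p : ℝ} (hp : 1 < p) (t : ℝ) : sinpWave p t ∈ Icc (0 : ℝ) 1 :=
  (sinpHalf_spec hp (fold_mem hp t)).1

theorem one_sub_sinpWave_rpow_nonneg {p : ℝ} (hp : 1 < p) (t : ℝ) : 0 ≤ 1 - sinpWave p t ^ p := by
  have h := sinpWave_mem hp t
  linarith [Real.rpow_le_one h.1 h.2 (by linarith : 0 ≤ p)]

theorem continuous_sinpWave {p : ℝ} (hp : 1 < p) : Continuous (sinpWave p) :=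
  (continuousOn_sinpHalf hp).comp_continuous (by fun_prop) (fold_mem hp)

theorem sinpWave_of_le {p t : ℝ} (h0 : 0 ≤ t) (ht : t ≤ piP p / 2) :
    sinpWave p t = sinpHalf p t := by
  rw [sinpWave, min_eq_left (by linarith), max_eq_right h0]

theorem sinpWave_reflect (p t : ℝ) : sinpWave p (piP p - t) = sinpWave p t := by
  rw [sinpWave, sinpWave, _root_.sub_sub_cancel, min_comm]

theorem sinpWave_pi_div_two {p : ℝ} (hp : 1 < p) : sinpWave p (piP p / 2) = 1 := by
  rw [sinpWave_of_le (by linarith [piP_pos hp]) le_rfl, sinpHalf_pi_div_two hp]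

theorem sinpWave_eq_zero {p : ℝ} (hp : 1 < p) {t : ℝ} (ht : t ∉ Ioo 0 (piP p)) :
    sinpWave p t = 0 := by
  have : min t (piP p - t) ≤ 0 := by
    by_contra! h
    rw [lt_min_iff] at h
    exact ht ⟨h.1, by linarith⟩
  rw [sinpWave, max_eq_left this, sinpHalf_zero hp]

theorem sinpWave_pos {p : ℝ} (hp : 1 < p) {t : ℝ} (ht : t ∈ Ioo 0 (piP p)) :
    0 < sinpWave p t := by
  refine sinpHalf_pos hp ⟨?_, (fold_mem hp t).2⟩
  exact lt_max_of_lt_right (lt_min ht.1 (by linarith [ht.2]))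

theorem sinp_eq_sinpWave {p : ℝ} (hp : 1 < p) {t : ℝ} (ht : t ∈ Ioo 0 (piP p)) :
    sinp p t = sinpWave p t := by
  have hpi := piP_pos hp
  have hfl : ⌊(t + piP p) / (2 * piP p)⌋ = 0 := by
    rw [Int.floor_eq_zero_iff]
    refine ⟨div_nonneg (by linarith [ht.1]) (by linarith), ?_⟩
    rw [div_lt_one (by linarith)]
    linarith [ht.2]
  rw [sinp, hfl]
  simp only [Int.cast_zero, mul_zero, sub_zero, sinpSym, if_pos ht.1.le, sinpBase]
  split_ifs with h
  · rw [sinpWave_of_le ht.1.le h]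
  · rw [← sinpWave_reflect, sinpWave_of_le (by linarith [ht.2]) (by linarith)]

theorem cospWave_pi_div_two {p : ℝ} (hp : 1 < p) : cospWave p (piP p / 2) = 0 := by
  rw [cospWave, if_pos le_rfl, sinpWave_pi_div_two hp]
  rw [Real.one_rpow, sub_self, Real.zero_rpow]
  have : 0 < 1 / p := by positivity
  exact this.ne'

theorem cospWave_reflect {p : ℝ} (hp : 1 < p) (t : ℝ) :
    cospWave p (piP p - t) = -cospWave p t := by
  rcases lt_trichotomy t (piP p / 2) with h | rfl | h
  · rw [cospWave, cospWave, if_neg (by linarith), if_pos h.le, sinpWave_reflect]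
  · rw [_root_.sub_half, cospWave_pi_div_two hp, neg_zero]
  · rw [cospWave, cospWave, if_pos (by linarith), if_neg (by linarith), sinpWave_reflect, neg_neg]

theorem continuous_cospWave {p : ℝ} (hp : 1 < p) : Continuous (cospWave p) := by
  have hp0 : 0 < p := by linarith
  have hc : Continuous fun t => (1 - sinpWave p t ^ p) ^ (1 / p) := by
    refine Continuous.rpow_const ?_ fun x => Or.inr (by positivity)
    exact continuous_const.sub ((continuous_sinpWave hp).rpow_const fun x => Or.inr hp0.le)
  refine hc.if_le hc.neg continuous_id continuous_const ?_
  rintro x (rfl : x = piP p / 2)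
  have := cospWave_pi_div_two hp
  rw [cospWave, if_pos le_rfl] at this
  simp only [this, neg_zero]

theorem hasDerivAt_of_eventually_ne {f g : ℝ → ℝ} {x : ℝ}
    (h : ∀ᶠ y in 𝓝[≠] x, HasDerivAt f (g y) y) (hf : ContinuousAt f x) (hg : ContinuousAt g x) :
    HasDerivAt f (g x) x := by
  have hA : HasDerivWithinAt f (g x) (Ici x) x := by
    have h1 : ∀ᶠ y in 𝓝[>] x, HasDerivAt f (g y) y := h.filter_mono (nhdsGT_le_nhdsNE x)
    refine hasDerivWithinAt_Ici_of_tendsto_deriv (s := {y | HasDerivAt f (g y) y})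
      (fun y hy => hy.differentiableAt.differentiableWithinAt) hf.continuousWithinAt h1 ?_
    refine (hg.tendsto.mono_left nhdsWithin_le_nhds).congr' ?_
    filter_upwards [h1] with y hy using hy.deriv.symm
  have hB : HasDerivWithinAt f (g x) (Iic x) x := by
    have h1 : ∀ᶠ y in 𝓝[<] x, HasDerivAt f (g y) y := h.filter_mono (nhdsLT_le_nhdsNE x)
    refine hasDerivWithinAt_Iic_of_tendsto_deriv (s := {y | HasDerivAt f (g y) y})
      (fun y hy => hy.differentiableAt.differentiableWithinAt) hf.continuousWithinAt h1 ?_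
    refine (hg.tendsto.mono_left nhdsWithin_le_nhds).congr' ?_
    filter_upwards [h1] with y hy using hy.deriv.symm
  simpa using hB.union hA

/-- A function on `(0, π_p)` whose derivative is known on the first half and which is even or odd
under reflection is differentiable on `(0, π_p)`. -/
theorem hasDerivAt_of_reflect {p : ℝ} {f g : ℝ → ℝ} (e : ℝ)
    (hf : Continuous f) (hg : Continuous g) (hfe : ∀ t, f t = e * f (piP p - t))
    (hge : ∀ t, g t = -(e * g (piP p - t)))
    (h : ∀ t ∈ Ioo 0 (piP p / 2), HasDerivAt f (g t) t) {t : ℝ} (ht : t ∈ Ioo 0 (piP p)) :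
    HasDerivAt f (g t) t := by
  have key : ∀ t ∈ Ioo 0 (piP p), t ≠ piP p / 2 → HasDerivAt f (g t) t := by
    intro t ht hne
    rcases lt_or_gt_of_ne hne with h' | h'
    · exact h t ⟨ht.1, h'⟩
    · have h1 := ((h (piP p - t) ⟨by linarith [ht.2], by linarith⟩).comp_const_sub (piP p) t).const_mul e
      rw [mul_neg, ← hge] at h1
      exact h1.congr_of_eventuallyEq (Eventually.of_forall hfe)
  by_cases h' : t = piP p / 2
  · refine hasDerivAt_of_eventually_ne ?_ hf.continuousAt hg.continuousAt
    filter_upwards [mem_nhdsWithin_of_mem_nhds (Ioo_mem_nhds ht.1 ht.2), self_mem_nhdsWithin]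
      with y hy hy2
    exact key y hy (by rw [← h']; exact hy2)
  · exact key t ht h'

theorem hasDerivAt_sinpWave_of_lt {p : ℝ} (hp : 1 < p) {t : ℝ} (ht : t ∈ Ioo 0 (piP p / 2)) :
    HasDerivAt (sinpWave p) (cospWave p t) t := by
  rw [cospWave, if_pos ht.2.le, sinpWave_of_le ht.1.le ht.2.le]
  refine (hasDerivAt_sinpHalf hp ht).congr_of_eventuallyEq ?_
  filter_upwards [Icc_mem_nhds ht.1 ht.2] with y hy using sinpWave_of_le hy.1 hy.2

theorem hasDerivAt_sinpWave {p : ℝ} (hp : 1 < p) {t : ℝ} (ht : t ∈ Ioo 0 (piP p)) :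
    HasDerivAt (sinpWave p) (cospWave p t) t :=
  hasDerivAt_of_reflect 1 (continuous_sinpWave hp) (continuous_cospWave hp)
    (fun t => by rw [sinpWave_reflect, one_mul])
    (fun t => by rw [cospWave_reflect hp, one_mul, neg_neg])
    (fun _ => hasDerivAt_sinpWave_of_lt hp) ht

theorem hasDerivAt_oddPow_cospWave {p : ℝ} (hp : 1 < p) {t : ℝ} (ht : t ∈ Ioo 0 (piP p)) :
    HasDerivAt (fun t => oddPow p (cospWave p t)) (-((p - 1) * sinpWave p t ^ (p - 1))) t := by
  have hp0 : 0 < p := by linarith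
  refine hasDerivAt_of_reflect (g := fun t => -((p - 1) * sinpWave p t ^ (p - 1))) (-1)
    ((continuous_oddPow hp).comp (continuous_cospWave hp)) ?_
    (fun t => by simp only [Function.comp_apply, cospWave_reflect hp, oddPow_neg]; ring)
    (fun t => by rw [sinpWave_reflect]; ring) ?_ ht
  · exact (continuous_const.mul
      ((continuous_sinpWave hp).rpow_const fun x => Or.inr (by linarith))).neg
  intro t ht
  have hs0 : 0 < sinpWave p t := sinpWave_pos hp ⟨ht.1, by linarith [ht.1, ht.2]⟩
  have hs1 : sinpWave p t < 1 := by
    rw [sinpWave_of_le ht.1.le ht.2.le]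
    exact sinpHalf_lt_one hp (Ioo_subset_Ico_self ht)
  have hb : 0 < 1 - sinpWave p t ^ p := by
    have : sinpWave p t ^ p < 1 := Real.rpow_lt_one hs0.le hs1 hp0
    linarith
  have h1 := (((hasDerivAt_sinpWave_of_lt hp ht).rpow_const (p := p)
    (Or.inl hs0.ne')).const_sub 1).rpow_const (p := (p - 1) / p) (Or.inl hb.ne')
  have h2 : (fun t => oddPow p (cospWave p t)) =ᶠ[𝓝 t]
      fun t => (1 - sinpWave p t ^ p) ^ ((p - 1) / p) := by
    filter_upwards [Iio_mem_nhds ht.2] with y hy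
    have hb := one_sub_sinpWave_rpow_nonneg hp y
    rw [cospWave, if_pos (le_of_lt hy), oddPow_of_nonneg hp (Real.rpow_nonneg hb _),
      ← Real.rpow_mul hb]
    congr 1; ring
  refine (h1.congr_of_eventuallyEq h2).congr_deriv ?_
  rw [cospWave, if_pos ht.2.le]
  have h3 : (1 - sinpWave p t ^ p) ^ (1 / p) * (1 - sinpWave p t ^ p) ^ ((p - 1) / p - 1) = 1 := by
    rw [← Real.rpow_add hb]
    have : 1 / p + ((p - 1) / p - 1) = 0 := by field_simp; ring
    rw [this, Real.rpow_zero]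
  calc _ = -((p - 1) * sinpWave p t ^ (p - 1)) * ((1 - sinpWave p t ^ p) ^ (1 / p) *
        (1 - sinpWave p t ^ p) ^ ((p - 1) / p - 1)) := by field_simp
    _ = _ := by rw [h3, mul_one]

/-- `w` is a positive first Dirichlet eigenfunction of the one-dimensional `p`-Laplacian on
`(a, b)`, extended by zero, with derivative `v` and eigenvalue `l`. -/
structure EigenProfile (p a b : ℝ) (w v : ℝ → ℝ) (l : ℝ) : Prop where
  continuous_fun : Continuous w
  continuous_der : Continuous v
  pos : ∀ t ∈ Ioo a b, 0 < w t
  eq_zero : ∀ t ∉ Ioo a b, w t = 0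
  hasDerivAt : ∀ t ∈ Ioo a b, HasDerivAt w (v t) t
  riccati : ∀ t ∈ Ioo a b,
    HasDerivAt (fun t => oddPow p (v t / w t)) (-l - (p - 1) * |v t / w t| ^ p) t
  integral_eq : ∫ t in Ioo a b, |v t| ^ p = l * ∫ t in Ioo a b, |w t| ^ p
  eigenvalue_nonneg : 0 ≤ l

theorem mul_sub_mem_Ioo {c a b t : ℝ} (hab : a < b) (hc : 0 < c) (ht : t ∈ Ioo a b) :
    c / (b - a) * (t - a) ∈ Ioo 0 c := by
  have h : 0 < b - a := by linarith
  refine ⟨mul_pos (div_pos hc h) (by linarith [ht.1]), ?_⟩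
  rw [div_mul_eq_mul_div, div_lt_iff₀ h]
  exact mul_lt_mul_of_pos_left (by linarith [ht.2]) hc

theorem mem_Ioo_of_mul_sub_mem {c a b t : ℝ} (hab : a < b) (hc : 0 < c)
    (ht : c / (b - a) * (t - a) ∈ Ioo 0 c) : t ∈ Ioo a b := by
  have h : 0 < b - a := by linarith
  have h1 := ht.1
  have h2 := ht.2
  rw [div_mul_eq_mul_div, div_lt_iff₀ h, mul_lt_mul_iff_right₀ hc] at h2
  rw [mul_pos_iff_of_pos_left (div_pos hc h)] at h1
  exact ⟨by linarith, by linarith⟩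

theorem exists_eigenProfile {p : ℝ} (hp : 1 < p) {a b : ℝ} (hab : a < b) :
    ∃ (w v : ℝ → ℝ) (l : ℝ), EigenProfile p a b w v l ∧
      ∀ t ∈ Ioo a b, w t = sinp p (piP p * (t - a) / (b - a)) := by
  have hpi := piP_pos hp
  have hba : 0 < b - a := by linarith
  set κ := piP p / (b - a) with hκ
  have hκ0 : 0 < κ := div_pos hpi hba
  have hmem : ∀ t ∈ Ioo a b, κ * (t - a) ∈ Ioo 0 (piP p) := fun t => mul_sub_mem_Ioo hab hpi
  have hlin : ∀ t, HasDerivAt (fun t => κ * (t - a)) κ t := fun t => by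
    simpa using ((hasDerivAt_id t).sub_const a).const_mul κ
  have hw : ∀ t ∈ Ioo a b, HasDerivAt (fun t => sinpWave p (κ * (t - a)))
      (κ * cospWave p (κ * (t - a))) t := fun t ht => by
    have := (hasDerivAt_sinpWave hp (hmem t ht)).comp t (hlin t)
    rwa [mul_comm] at this
  have hv : ∀ t ∈ Ioo a b, HasDerivAt (fun t => oddPow p (κ * cospWave p (κ * (t - a))))
      (-((p - 1) * κ ^ p * sinpWave p (κ * (t - a)) ^ (p - 1))) t := fun t ht => by
    have h1 := ((hasDerivAt_oddPow_cospWave hp (hmem t ht)).comp t (hlin t)).const_mul (κ ^ (p - 1))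
    have h2 : (fun t => oddPow p (κ * cospWave p (κ * (t - a)))) =
        fun t => κ ^ (p - 1) * oddPow p (cospWave p (κ * (t - a))) := by
      ext t; rw [oddPow_mul hκ0]
    rw [h2]
    refine h1.congr_deriv ?_
    have : κ ^ p = κ ^ (p - 1) * κ := by
      nth_rw 3 [← Real.rpow_one κ]
      rw [← Real.rpow_add hκ0]; ring_nf
    rw [this]; ring
  have hcw : Continuous fun t => sinpWave p (κ * (t - a)) :=
    (continuous_sinpWave hp).comp (by fun_prop)
  have hcv : Continuous fun t => κ * cospWave p (κ * (t - a)) :=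
    continuous_const.mul ((continuous_cospWave hp).comp (by fun_prop))
  have hpos : ∀ t ∈ Ioo a b, 0 < sinpWave p (κ * (t - a)) :=
    fun t ht => sinpWave_pos hp (hmem t ht)
  have hzero : ∀ t ∉ Ioo a b, sinpWave p (κ * (t - a)) = 0 :=
    fun t ht => sinpWave_eq_zero hp fun h => ht (mem_Ioo_of_mul_sub_mem hab hpi h)
  refine ⟨fun t => sinpWave p (κ * (t - a)), fun t => κ * cospWave p (κ * (t - a)),
    (p - 1) * κ ^ p, ⟨hcw, hcv, hpos, hzero, hw, ?_, ?_, ?_⟩, ?_⟩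
  · intro t ht
    have h0 := hpos t ht
    have h1 := (hv t ht).div ((hw t ht).rpow_const (p := p - 1) (Or.inl h0.ne'))
      (Real.rpow_pos_of_pos h0 _).ne'
    refine (h1.congr_of_eventuallyEq ?_).congr_deriv ?_
    · filter_upwards [Ioo_mem_nhds ht.1 ht.2] with s hs
      exact oddPow_div (hpos s hs)
    · generalize κ * cospWave p (κ * (t - a)) = c
      generalize sinpWave p (κ * (t - a)) = s at h0 ⊢
      rw [abs_div, abs_of_pos h0, Real.div_rpow (abs_nonneg _) h0.le, ← oddPow_mul_self hp c]
      have e1 : s ^ (p - 1 - 1) = s ^ (p - 1) / s := by rw [Real.rpow_sub_one h0.ne']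
      have e2 : s ^ p = s ^ (p - 1) * s := by rw [Real.rpow_sub_one h0.ne']; field_simp
      rw [e1, e2]
      have : 0 < s ^ (p - 1) := Real.rpow_pos_of_pos h0 _
      field_simp
  · have hF : ∀ t ∈ Ioo a b, HasDerivAt
        (fun t => oddPow p (κ * cospWave p (κ * (t - a))) * sinpWave p (κ * (t - a)))
        (|κ * cospWave p (κ * (t - a))| ^ p - (p - 1) * κ ^ p * |sinpWave p (κ * (t - a))| ^ p) t := by
      intro t ht
      have h0 := hpos t ht
      refine ((hv t ht).mul (hw t ht)).congr_deriv ?_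
      rw [oddPow_mul_self hp, ← oddPow_mul_self hp (sinpWave p _), oddPow_of_pos h0]
      ring
    have hc1 : Continuous fun t => |κ * cospWave p (κ * (t - a))| ^ p :=
      hcv.abs.rpow_const fun _ => Or.inr (by linarith)
    have hc2 : Continuous fun t => (p - 1) * κ ^ p * |sinpWave p (κ * (t - a))| ^ p :=
      continuous_const.mul (hcw.abs.rpow_const fun _ => Or.inr (by linarith))
    have h1 := intervalIntegral.integral_eq_sub_of_hasDerivAt_of_le hab.le
      (((continuous_oddPow hp).comp hcv).mul hcw).continuousOn hF
      ((hc1.sub hc2).intervalIntegrable _ _)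
    rw [intervalIntegral.integral_sub (hc1.intervalIntegrable _ _) (hc2.intervalIntegrable _ _),
      intervalIntegral.integral_const_mul, Pi.mul_apply, Pi.mul_apply, hzero a (by simp),
      hzero b (by simp)] at h1
    simp only [intervalIntegral.integral_of_le hab.le, integral_Ioc_eq_integral_Ioo] at h1
    linarith
  · exact mul_nonneg (by linarith) (Real.rpow_nonneg hκ0.le _)
  · intro t ht
    have := sinp_eq_sinpWave hp (hmem t ht)
    rw [hκ] at this ⊢
    refine this.symm.trans ?_
    congr 1; ring

/-- The remainder in the tangent line inequality for `x ↦ |x|^p`. -/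
noncomputable def tangentRem (p A B : ℝ) : ℝ := |A| ^ p - |B| ^ p - p * (oddPow p B * (A - B))

theorem tangentRem_self (p B : ℝ) : tangentRem p B B = 0 := by simp [tangentRem]

theorem tangentRem_pos {p : ℝ} (hp : 1 < p) {A B : ℝ} (hAB : A ≠ B) : 0 < tangentRem p A B := by
  rcases eq_or_ne B 0 with rfl | hB
  · rw [tangentRem, oddPow_zero, abs_zero, Real.zero_rpow (by linarith)]
    have := Real.rpow_pos_of_pos (abs_pos.2 hAB) p
    linarith
  · obtain ⟨t, rfl⟩ : ∃ t, A = B * t := ⟨A / B, by field_simp⟩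
    have ht : t ≠ 1 := fun h => hAB (by simp [h])
    have h1 : oddPow p B * (B * t - B) = |B| ^ p * (t - 1) := by
      rw [← oddPow_mul_self hp]; ring
    have h2 : 1 + p * (t - 1) < |t| ^ p := by
      rcases le_or_gt 0 t with h | h
      · have := one_add_mul_self_lt_rpow_one_add (s := t - 1) (by linarith)
          (sub_ne_zero.2 ht) hp
        rw [abs_of_nonneg h]
        rwa [add_sub_cancel] at this
      · have h3 : 0 ≤ |t| ^ p := Real.rpow_nonneg (abs_nonneg _) _
        nlinarith
    have h4 : 0 < |B| ^ p := Real.rpow_pos_of_pos (abs_pos.2 hB) p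
    rw [tangentRem, h1, abs_mul, Real.mul_rpow (abs_nonneg _) (abs_nonneg _)]
    nlinarith

theorem tangentRem_nonneg {p : ℝ} (hp : 1 < p) (A B : ℝ) : 0 ≤ tangentRem p A B := by
  rcases eq_or_ne A B with rfl | h
  · rw [tangentRem_self]
  · exact (tangentRem_pos hp h).le

theorem continuous_tangentRem {p : ℝ} (hp : 1 < p) :
    Continuous fun z : ℝ × ℝ => tangentRem p z.1 z.2 := by
  have h1 := (contDiff_abs_rpow hp).continuous
  have h2 := continuous_oddPow hp
  unfold tangentRem
  exact ((h1.comp continuous_fst).sub (h1.comp continuous_snd)).sub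
    (continuous_const.mul ((h2.comp continuous_snd).mul (continuous_fst.sub continuous_snd)))

theorem tangentRem_eq {p : ℝ} (hp : 1 < p) (A f q : ℝ) :
    tangentRem p A (f * q) =
      |A| ^ p + (p - 1) * (|f| ^ p * |q| ^ p) - p * oddPow p f * A * oddPow p q := by
  have h1 : oddPow p (f * q) = oddPow p f * oddPow p q := by
    simp only [oddPow, abs_mul]
    rw [Real.mul_rpow (abs_nonneg _) (abs_nonneg _)]; ring
  have h2 : oddPow p (f * q) * (A - f * q) = oddPow p f * oddPow p q * A - |f * q| ^ p := by
    rw [mul_sub, oddPow_mul_self hp, h1]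
  rw [tangentRem, h2, abs_mul, Real.mul_rpow (abs_nonneg _) (abs_nonneg _)]
  ring

section Jets

variable {n : ℕ} {p : ℝ}

theorem jet_zero (p : ℝ≥0∞) (u : (Fin n → ℝ) → ℝ) (x) : jet p u x 0 = u x := rfl

theorem jet_succ (p : ℝ≥0∞) (u : (Fin n → ℝ) → ℝ) (x) (i : Fin n) :
    jet p u x i.succ = pder i u x := rfl

theorem piLp_norm_rpow (hp : 1 < p) {m : ℕ} (y : PiLp (ENNReal.ofReal p) (fun _ : Fin m => ℝ)) :
    ‖y‖ ^ p = ∑ i, |y i| ^ p := by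
  have hp0 : 0 < p := by linarith
  have h : (ENNReal.ofReal p).toReal = p := ENNReal.toReal_ofReal hp0.le
  rw [PiLp.norm_eq_sum (by rw [h]; exact hp0), h, ← Real.rpow_mul
    (Finset.sum_nonneg fun i _ => Real.rpow_nonneg (norm_nonneg _) _), one_div,
    inv_mul_cancel₀ hp0.ne', Real.rpow_one]
  rfl

theorem lintegral_norm_rpow_eq (hp : 1 < p) {E : Type*} [NormedAddCommGroup E]
    {α : Type*} [MeasurableSpace α] {μ : Measure α}
    [Fact (1 ≤ ENNReal.ofReal p)] (F : Lp E (ENNReal.ofReal p) μ) :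
    ∫⁻ x, ENNReal.ofReal (‖F x‖ ^ p) ∂μ = ENNReal.ofReal (‖F‖ ^ p) := by
  have hp0 : 0 < p := by linarith
  have h : (ENNReal.ofReal p).toReal = p := ENNReal.toReal_ofReal hp0.le
  have h1 := eLpNorm_eq_lintegral_rpow_enorm_toReal (f := F) (μ := μ)
    (p := ENNReal.ofReal p) (by simpa using hp0) ENNReal.ofReal_ne_top
  rw [h] at h1
  have h2 : (eLpNorm F (ENNReal.ofReal p) μ) ^ p = ∫⁻ x, ‖F x‖ₑ ^ p ∂μ := by
    rw [h1, ← ENNReal.rpow_mul, one_div, inv_mul_cancel₀ hp0.ne', ENNReal.rpow_one]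
  rw [← ENNReal.ofReal_rpow_of_nonneg (norm_nonneg _) hp0.le, Lp.norm_def,
    ENNReal.ofReal_toReal (Lp.eLpNorm_ne_top F), h2]
  refine lintegral_congr fun x => ?_
  rw [← ENNReal.ofReal_rpow_of_nonneg (norm_nonneg _) hp0.le, ofReal_norm]

theorem pder_continuous {u : (Fin n → ℝ) → ℝ} (hu : ContDiff ℝ 1 u) (i : Fin n) :
    Continuous (pder i u) :=
  (hu.continuous_fderiv one_ne_zero).clm_apply continuous_const

theorem hasCompactSupport_pder {u : (Fin n → ℝ) → ℝ} (hu : HasCompactSupport u) (i : Fin n) :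
    HasCompactSupport (pder i u) :=
  (hu.fderiv ℝ).comp_left (g := fun L : (Fin n → ℝ) →L[ℝ] ℝ => L (Pi.single i 1)) (by simp)

theorem pder_eq_zero {u : (Fin n → ℝ) → ℝ} (i : Fin n) {x : Fin n → ℝ} (hx : x ∉ tsupport u) :
    pder i u x = 0 := by
  have : fderiv ℝ u x = 0 := by
    by_contra h
    exact hx (support_fderiv_subset ℝ h)
  simp [pder, this]

theorem continuous_jet (P : ℝ≥0∞) [Fact (1 ≤ P)] {u : (Fin n → ℝ) → ℝ} (hu : ContDiff ℝ 1 u) :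
    Continuous (jet P u) := by
  refine (PiLp.continuous_toLp P _).comp (continuous_pi fun j => ?_)
  refine Fin.cases ?_ (fun i => ?_) j
  · exact hu.continuous
  · exact pder_continuous hu i

theorem jet_eq_zero (P : ℝ≥0∞) {u : (Fin n → ℝ) → ℝ} {x : Fin n → ℝ} (hx : x ∉ tsupport u) :
    jet P u x = 0 := by
  ext j
  refine Fin.cases ?_ (fun i => ?_) j
  · rw [jet_zero, image_eq_zero_of_notMem_tsupport hx]; rfl
  · rw [jet_succ, pder_eq_zero i hx]; rfl

theorem hasCompactSupport_jet (P : ℝ≥0∞) [Fact (1 ≤ P)] {u : (Fin n → ℝ) → ℝ}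
    (hu : HasCompactSupport u) : HasCompactSupport (jet P u) :=
  HasCompactSupport.intro hu fun _ => jet_eq_zero P

theorem memLp_jet (P : ℝ≥0∞) [Fact (1 ≤ P)] {u : (Fin n → ℝ) → ℝ} (hu : ContDiff ℝ 1 u)
    (hc : HasCompactSupport u) : MemLp (jet P u) P volume :=
  (continuous_jet P hu).memLp_of_hasCompactSupport (hasCompactSupport_jet P hc)

theorem jet_add (P : ℝ≥0∞) {u v : (Fin n → ℝ) → ℝ} (hu : Differentiable ℝ u)
    (hv : Differentiable ℝ v) : jet P (u + v) = jet P u + jet P v := by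
  ext x j
  refine Fin.cases ?_ (fun i => ?_) j
  · rfl
  · simp only [Pi.add_apply, PiLp.add_apply, jet_succ, pder, fderiv_add (hu x) (hv x)]
    rfl

theorem jet_smul (P : ℝ≥0∞) {u : (Fin n → ℝ) → ℝ} (hu : Differentiable ℝ u) (c : ℝ) :
    jet P (c • u) = c • jet P u := by
  ext x j
  refine Fin.cases ?_ (fun i => ?_) j
  · rfl
  · simp only [Pi.smul_apply, PiLp.smul_apply, jet_succ, pder, fderiv_const_smul (hu x) c]
    rfl

variable {D : Set (Fin n → ℝ)}

theorem IsTestFun.add {u v : (Fin n → ℝ) → ℝ} (hu : IsTestFun D u) (hv : IsTestFun D v) :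
    IsTestFun D (u + v) :=
  ⟨hu.1.add hv.1, hu.2.1.add hv.2.1, (tsupport_add u v).trans (union_subset hu.2.2 hv.2.2)⟩

theorem IsTestFun.const_smul {u : (Fin n → ℝ) → ℝ} (hu : IsTestFun D u) (c : ℝ) :
    IsTestFun D (c • u) :=
  ⟨contDiff_const.smul hu.1, hu.2.1.smul_left (f := fun _ => c),
    (tsupport_smul_subset_right (fun _ => c) u).trans hu.2.2⟩

theorem IsTestFun.zero : IsTestFun D (0 : (Fin n → ℝ) → ℝ) :=
  ⟨contDiff_const, HasCompactSupport.zero, by simp [tsupport]⟩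

theorem IsTestFun.contDiff_one {u : (Fin n → ℝ) → ℝ} (hu : IsTestFun D u) : ContDiff ℝ 1 u :=
  hu.1.of_le (by exact_mod_cast le_top)

theorem exists_testFun_of_mem_span (P : ℝ≥0∞) [Fact (1 ≤ P)] {F : Vsp n P}
    (hF : F ∈ Submodule.span ℝ {f : Vsp n P | ∃ u : (Fin n → ℝ) → ℝ, IsTestFun D u ∧
      (f : (Fin n → ℝ) → PiLp P (fun _ : Fin (n + 1) => ℝ)) =ᵐ[volume] jet P u}) :
    ∃ u : (Fin n → ℝ) → ℝ, IsTestFun D u ∧ F =ᵐ[volume] jet P u := by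
  induction hF using Submodule.span_induction with
  | mem x h => exact h
  | zero =>
    refine ⟨0, IsTestFun.zero, ?_⟩
    filter_upwards [Lp.coeFn_zero (PiLp P (fun _ : Fin (n + 1) => ℝ)) P
      (volume : Measure (Fin n → ℝ))] with x hx
    rw [hx, jet_eq_zero P (by simp [tsupport])]; rfl
  | add F G _ _ hF hG =>
    obtain ⟨u, hu, hFu⟩ := hF
    obtain ⟨v, hv, hGv⟩ := hG
    refine ⟨u + v, hu.add hv, ?_⟩
    rw [jet_add P (hu.contDiff_one.differentiable one_ne_zero)
      (hv.contDiff_one.differentiable one_ne_zero)]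
    filter_upwards [Lp.coeFn_add F G, hFu, hGv] with x h1 h2 h3
    rw [h1, Pi.add_apply, Pi.add_apply, h2, h3]
  | smul c F _ hF =>
    obtain ⟨u, hu, hFu⟩ := hF
    refine ⟨c • u, hu.const_smul c, ?_⟩
    rw [jet_smul P (hu.contDiff_one.differentiable one_ne_zero)]
    filter_upwards [Lp.coeFn_smul c F, hFu] with x h1 h2
    rw [h1, Pi.smul_apply, Pi.smul_apply, h2]

theorem exists_testFun_seq (P : ℝ≥0∞) [Fact (1 ≤ P)] {G : Vsp n P}
    (hG : G ∈ W0sub P D) :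
    ∃ (φ : ℕ → (Fin n → ℝ) → ℝ) (F : ℕ → Vsp n P), (∀ k, IsTestFun D (φ k)) ∧
      (∀ k, F k =ᵐ[volume] jet P (φ k)) ∧ Tendsto F atTop (𝓝 G) ∧
      ∀ᵐ x, Tendsto (fun k => jet P (φ k) x) atTop (𝓝 (G x)) := by
  have hG' : G ∈ closure (Submodule.span ℝ {f : Vsp n P | ∃ u : (Fin n → ℝ) → ℝ, IsTestFun D u ∧
      (f : (Fin n → ℝ) → PiLp P (fun _ : Fin (n + 1) => ℝ)) =ᵐ[volume] jet P u} : Set (Vsp n P)) := by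
    rw [← Submodule.topologicalClosure_coe]; exact hG
  obtain ⟨F, hF, hlim⟩ := mem_closure_iff_seq_limit.1 hG'
  choose φ hφ hFφ using fun k => exists_testFun_of_mem_span P (hF k)
  obtain ⟨ns, hns, hae⟩ := (tendstoInMeasure_of_tendsto_Lp hlim).exists_seq_tendsto_ae
  refine ⟨fun k => φ (ns k), fun k => F (ns k), fun k => hφ _, fun k => hFφ _,
    hlim.comp hns.tendsto_atTop, ?_⟩
  filter_upwards [hae, ae_all_iff.2 hFφ] with x hx hx2
  exact hx.congr fun k => hx2 _

theorem ae_eq_zero_of_mem_W0sub (P : ℝ≥0∞) [Fact (1 ≤ P)] {G : Vsp n P} (hG : G ∈ W0sub P D) :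
    ∀ᵐ x, x ∉ D → G x = 0 := by
  obtain ⟨φ, F, hφ, -, -, hae⟩ := exists_testFun_seq P hG
  filter_upwards [hae] with x hx hxD
  refine tendsto_nhds_unique hx ?_
  refine tendsto_const_nhds.congr fun k => ?_
  rw [jet_eq_zero P fun h => hxD ((hφ k).2.2 h)]

/-- Integration by parts against a function which is differentiable near the support. -/
theorem integral_mul_eq_neg_of_hasLineDerivAt {f g g' : (Fin n → ℝ) → ℝ} (hf : ContDiff ℝ 1 f)
    (hc : HasCompactSupport f) (i : Fin n) (hg : ∀ x ∈ tsupport f, ContinuousAt g x)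
    (hg' : ∀ x ∈ tsupport f, ContinuousAt g' x)
    (hgg' : ∀ x ∈ tsupport f, HasLineDerivAt ℝ g (g' x) x (Pi.single i 1)) :
    Integrable (fun x => f x * g' x) ∧ Integrable (fun x => pder i f x * g x) ∧
      ∫ x, f x * g' x = -∫ x, pder i f x * g x := by
  have key : ∀ u v : (Fin n → ℝ) → ℝ, Continuous u → tsupport u ⊆ tsupport f →
      (∀ x ∈ tsupport f, ContinuousAt v x) → Integrable (fun x => u x * v x) := by
    intro u v hu hsub hv
    have hsub' : tsupport (fun x => u x * v x) ⊆ tsupport f :=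
      (tsupport_mul_subset_left (f := u) (g := v)).trans hsub
    refine Continuous.integrable_of_hasCompactSupport ?_ ?_
    · refine continuous_of_tsupport fun x hx => hu.continuousAt.mul (hv x (hsub' hx))
    · exact hc.of_isClosed_subset (isClosed_tsupport _) hsub'
  have hsf : tsupport (pder i f) ⊆ tsupport f :=
    closure_minimal (fun x hx => by_contra fun h => hx (pder_eq_zero i h)) (isClosed_tsupport _)
  have h1 := key f g' hf.continuous subset_rfl hg'
  have h2 := key (pder i f) g (pder_continuous hf i) hsf hg
  have h3 := key f g hf.continuous subset_rfl hg
  refine ⟨h1, h2, ?_⟩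
  refine integral_bilinear_hasLineDerivAt_right_eq_neg_left_of_integrable
    (B := ContinuousLinearMap.mul ℝ ℝ) (v := Pi.single i 1) h2 h1 h3 (fun x _ => ?_) hgg'
  exact (hf.differentiable one_ne_zero x).hasFDerivAt.hasLineDerivAt _

end Jets

section Rectangle

variable {n : ℕ} {p : ℝ} {a b : Fin n → ℝ} {w v : Fin n → ℝ → ℝ} {l : Fin n → ℝ}

theorem mem_stripDomain_zero {x : Fin n → ℝ} :
    x ∈ stripDomain n 0 a b ↔ ∀ i, x i ∈ Ioo (a i) (b i) :=
  ⟨fun h i => h i (Nat.zero_le _), fun h i _ => h i⟩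

theorem stripDomain_zero_eq_pi : stripDomain n 0 a b = univ.pi fun i => Ioo (a i) (b i) := by
  ext x; simp [mem_stripDomain_zero]

theorem isOpen_stripDomain_zero : IsOpen (stripDomain n 0 a b) := by
  rw [stripDomain_zero_eq_pi]
  exact isOpen_set_pi finite_univ fun i _ => isOpen_Ioo

theorem EigenProfile.measurable_div {a b : ℝ} {w v : ℝ → ℝ} {l : ℝ}
    (H : EigenProfile p a b w v l) (i : Fin n) :
    Measurable fun x : Fin n → ℝ => v (x i) / w (x i) :=
  (H.continuous_der.measurable.comp (measurable_pi_apply i)).div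
    (H.continuous_fun.measurable.comp (measurable_pi_apply i))

theorem EigenProfile.continuousAt_div {a b : ℝ} {w v : ℝ → ℝ} {l : ℝ}
    (H : EigenProfile p a b w v l) {i : Fin n} {x : Fin n → ℝ} (hx : x i ∈ Ioo a b) :
    ContinuousAt (fun x : Fin n → ℝ => v (x i) / w (x i)) x :=
  (H.continuous_der.comp (continuous_apply i)).continuousAt.div
    (H.continuous_fun.comp (continuous_apply i)).continuousAt (H.pos _ hx).ne'

theorem contDiff_abs_rpow_comp (hp : 1 < p) {φ : (Fin n → ℝ) → ℝ} (hφ : ContDiff ℝ 1 φ) :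
    ContDiff ℝ 1 fun x => |φ x| ^ p :=
  (contDiff_abs_rpow hp).comp hφ

theorem pder_abs_rpow (hp : 1 < p) {φ : (Fin n → ℝ) → ℝ} (hφ : ContDiff ℝ 1 φ) (i : Fin n)
    (x : Fin n → ℝ) : pder i (fun x => |φ x| ^ p) x = p * oddPow p (φ x) * pder i φ x := by
  have h := (hasDerivAt_abs_rpow_oddPow hp (φ x)).comp_hasFDerivAt x
    (hφ.differentiable one_ne_zero x).hasFDerivAt
  rw [pder, show fderiv ℝ (fun x => |φ x| ^ p) x = _ from h.fderiv]
  simp [pder]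

theorem tsupport_abs_rpow_subset (hp : 1 < p) (φ : (Fin n → ℝ) → ℝ) :
    tsupport (fun x => |φ x| ^ p) ⊆ tsupport φ := by
  refine closure_mono fun x hx h => hx ?_
  simp only [h, abs_zero]
  exact Real.zero_rpow (by linarith)

theorem Filter.Tendsto.tangentRem (hp : 1 < p) {α : Type*} {L : Filter α} {f g : α → ℝ} {A B : ℝ}
    (hf : Tendsto f L (𝓝 A)) (hg : Tendsto g L (𝓝 B)) :
    Tendsto (fun k => tangentRem p (f k) (g k)) L (𝓝 (tangentRem p A B)) := by
  have h := (continuous_tangentRem hp).tendsto (A, B)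
  have h2 := h.comp (hf.prodMk_nhds hg)
  exact h2

theorem AEMeasurable.tangentRem (hp : 1 < p) {α : Type*} [MeasurableSpace α] {μ : Measure α}
    {f g : α → ℝ} (hf : AEMeasurable f μ) (hg : AEMeasurable g μ) :
    AEMeasurable (fun k => tangentRem p (f k) (g k)) μ :=
  (continuous_tangentRem hp).measurable.comp_aemeasurable (hf.prodMk hg)

theorem Measurable.tangentRem (hp : 1 < p) {α : Type*} [MeasurableSpace α]
    {f g : α → ℝ} (hf : Measurable f) (hg : Measurable g) :
    Measurable (fun k => tangentRem p (f k) (g k)) :=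
  (continuous_tangentRem hp).measurable.comp (hf.prodMk hg)

/-- Picone's identity for a test function on a rectangle. -/
theorem integral_tangentRem (hp : 1 < p) {i : Fin n} {w v : ℝ → ℝ} {l : ℝ}
    (H : EigenProfile p (a i) (b i) w v l) {φ : (Fin n → ℝ) → ℝ}
    (hφ : IsTestFun (stripDomain n 0 a b) φ) :
    Integrable (fun x => tangentRem p (pder i φ x) (φ x * (v (x i) / w (x i)))) ∧
      ∫ x, tangentRem p (pder i φ x) (φ x * (v (x i) / w (x i))) =
        (∫ x, |pder i φ x| ^ p) - l * ∫ x, |φ x| ^ p := by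
  have hp0 : 0 < p := by linarith
  have hF := contDiff_abs_rpow_comp hp hφ.contDiff_one
  have hsub := tsupport_abs_rpow_subset hp φ
  have hFc : HasCompactSupport fun x => |φ x| ^ p :=
    hφ.2.1.of_isClosed_subset (isClosed_tsupport _) hsub
  have hmem : ∀ x ∈ tsupport (fun x => |φ x| ^ p), x i ∈ Ioo (a i) (b i) := fun x hx =>
    mem_stripDomain_zero.1 (hφ.2.2 (hsub hx)) i
  have hq := fun x hx => H.continuousAt_div (hmem x hx)
  obtain ⟨h1, h2, h3⟩ := integral_mul_eq_neg_of_hasLineDerivAt hF hFc i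
    (g := fun x => oddPow p (v (x i) / w (x i)))
    (g' := fun x => -l - (p - 1) * |v (x i) / w (x i)| ^ p)
    (fun x hx => (continuous_oddPow hp).continuousAt.comp (hq x hx))
    (fun x hx => continuousAt_const.sub (continuousAt_const.mul
      ((contDiff_abs_rpow hp).continuous.continuousAt.comp (hq x hx))))
    (fun x hx => by
      have h := H.riccati _ (hmem x hx)
      have h' : HasDerivAt (fun t : ℝ => x i + t) 1 0 := by
        simpa using (hasDerivAt_id (0 : ℝ)).const_add (x i)
      have := HasDerivAt.comp (0 : ℝ) (by simpa using h) h'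
      simpa [HasLineDerivAt, Function.comp_def] using this)
  have hi1 : Integrable fun x => |φ x| ^ p := hF.continuous.integrable_of_hasCompactSupport hFc
  have hi2 : Integrable fun x => |pder i φ x| ^ p := by
    refine Continuous.integrable_of_hasCompactSupport
      ((contDiff_abs_rpow hp).continuous.comp (pder_continuous hφ.contDiff_one i)) ?_
    exact (hasCompactSupport_pder hφ.2.1 i).comp_left (g := fun t : ℝ => |t| ^ p)
      (by simp [hp0.ne'])
  have heq : (fun x => tangentRem p (pder i φ x) (φ x * (v (x i) / w (x i)))) = fun x =>
      (|pder i φ x| ^ p - l * |φ x| ^ p) -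
      (|φ x| ^ p * (-l - (p - 1) * |v (x i) / w (x i)| ^ p) +
        pder i (fun x => |φ x| ^ p) x * oddPow p (v (x i) / w (x i))) := by
    funext x
    rw [tangentRem_eq hp, pder_abs_rpow hp hφ.contDiff_one]
    ring
  rw [heq]
  have h4 : Integrable fun x => |pder i φ x| ^ p - l * |φ x| ^ p := hi2.sub (hi1.const_mul l)
  have h5 : Integrable fun x => |φ x| ^ p * (-l - (p - 1) * |v (x i) / w (x i)| ^ p) +
      pder i (fun x => |φ x| ^ p) x * oddPow p (v (x i) / w (x i)) := h1.add h2
  refine ⟨h4.sub h5, ?_⟩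
  rw [integral_sub h4 h5, integral_sub hi2 (hi1.const_mul l),
    integral_add h1 h2, h3, integral_const_mul]
  ring

theorem norm_jet_rpow (hp : 1 < p) (φ : (Fin n → ℝ) → ℝ) (x : Fin n → ℝ) :
    ‖jet (ENNReal.ofReal p) φ x‖ ^ p = |φ x| ^ p + ∑ i, |pder i φ x| ^ p := by
  rw [piLp_norm_rpow hp, Fin.sum_univ_succ]
  rfl

theorem lintegral_energy_test (hp : 1 < p) (H : ∀ i, EigenProfile p (a i) (b i) (w i) (v i) (l i))
    {φ : (Fin n → ℝ) → ℝ} (hφ : IsTestFun (stripDomain n 0 a b) φ) :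
    ∫⁻ x, ENNReal.ofReal ((∑ i, tangentRem p (pder i φ x) (φ x * (v i (x i) / w i (x i)))) +
        (1 + ∑ i, l i) * |φ x| ^ p) =
      ∫⁻ x, ENNReal.ofReal (‖jet (ENNReal.ofReal p) φ x‖ ^ p) := by
  have hp0 : 0 < p := by linarith
  have hi1 : Integrable fun x => |φ x| ^ p := by
    refine (contDiff_abs_rpow_comp hp hφ.contDiff_one).continuous.integrable_of_hasCompactSupport ?_
    exact hφ.2.1.comp_left (g := fun t : ℝ => |t| ^ p) (by simp [hp0.ne'])
  have hi2 : ∀ i, Integrable fun x => |pder i φ x| ^ p := by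
    intro i
    refine Continuous.integrable_of_hasCompactSupport
      ((contDiff_abs_rpow hp).continuous.comp (pder_continuous hφ.contDiff_one i)) ?_
    exact (hasCompactSupport_pder hφ.2.1 i).comp_left (g := fun t : ℝ => |t| ^ p)
      (by simp [hp0.ne'])
  have h := fun i => integral_tangentRem hp (H i) hφ
  have hl : 0 ≤ 1 + ∑ i, l i :=
    add_nonneg zero_le_one (Finset.sum_nonneg fun i _ => (H i).eigenvalue_nonneg)
  simp only [norm_jet_rpow hp]
  rw [← ofReal_integral_eq_lintegral_ofReal, ← ofReal_integral_eq_lintegral_ofReal,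
    integral_add (integrable_finsetSum _ fun i _ => (h i).1) (hi1.const_mul _),
    integral_add hi1 (integrable_finsetSum _ fun i _ => hi2 i),
    integral_finsetSum _ fun i _ => (h i).1, integral_finsetSum _ fun i _ => hi2 i,
    integral_const_mul, Finset.sum_congr rfl fun i _ => (h i).2, Finset.sum_sub_distrib,
    ← Finset.sum_mul]
  · congr 1; ring
  · exact hi1.add (integrable_finsetSum _ fun i _ => hi2 i)
  · exact Eventually.of_forall fun x => by positivity
  · exact (integrable_finsetSum _ fun i _ => (h i).1).add (hi1.const_mul _)
  · exact Eventually.of_forall fun x =>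
      add_nonneg (Finset.sum_nonneg fun i _ => tangentRem_nonneg hp _ _) (by positivity)

variable [Fact (1 ≤ ENNReal.ofReal p)]

theorem lintegral_energy_le (hp : 1 < p) (H : ∀ i, EigenProfile p (a i) (b i) (w i) (v i) (l i))
    {G : Vsp n (ENNReal.ofReal p)} (hG : G ∈ W0sub (ENNReal.ofReal p) (stripDomain n 0 a b)) :
    ∫⁻ x, ENNReal.ofReal
      ((∑ i : Fin n, tangentRem p (G x i.succ) (G x 0 * (v i (x i) / w i (x i)))) +
        (1 + ∑ i, l i) * |G x 0| ^ p) ≤ ENNReal.ofReal (‖G‖ ^ p) := by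
  have hp0 : 0 < p := by linarith
  obtain ⟨φ, F, hφ, hF, hlim, hae⟩ := exists_testFun_seq _ hG
  have hcont := (contDiff_abs_rpow hp).continuous
  have hnorm : ∀ k, ∫⁻ x, ENNReal.ofReal
      ((∑ i, tangentRem p (pder i (φ k) x) (φ k x * (v i (x i) / w i (x i)))) +
        (1 + ∑ i, l i) * |φ k x| ^ p) = ENNReal.ofReal (‖F k‖ ^ p) := by
    intro k
    rw [lintegral_energy_test hp H (hφ k), ← lintegral_norm_rpow_eq hp (F k)]
    refine lintegral_congr_ae ?_
    filter_upwards [hF k] with x hx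
    rw [hx]
  calc _ = ∫⁻ x, liminf (fun k => ENNReal.ofReal
      ((∑ i, tangentRem p (pder i (φ k) x) (φ k x * (v i (x i) / w i (x i)))) +
        (1 + ∑ i, l i) * |φ k x| ^ p)) atTop := by
        refine lintegral_congr_ae ?_
        filter_upwards [hae] with x hx
        have hc : ∀ j, Tendsto (fun k => jet (ENNReal.ofReal p) (φ k) x j) atTop (𝓝 (G x j)) :=
          fun j => ((PiLp.continuous_apply _ _ j).tendsto _).comp hx
        refine (Tendsto.liminf_eq ?_).symm
        refine ENNReal.tendsto_ofReal (Tendsto.add ?_ ?_)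
        · refine tendsto_finsetSum _ fun i _ => ?_
          have e1 : Tendsto (fun k => pder i (φ k) x) atTop (𝓝 (G x i.succ)) := hc i.succ
          have e0 : Tendsto (fun k => φ k x) atTop (𝓝 (G x 0)) := hc 0
          exact e1.tangentRem hp (e0.mul_const _)
        · have e0 : Tendsto (fun k => φ k x) atTop (𝓝 (G x 0)) := hc 0
          exact (Tendsto.comp (hcont.tendsto (G x 0)) e0).const_mul _
    _ ≤ liminf (fun k => ∫⁻ x, ENNReal.ofReal
      ((∑ i, tangentRem p (pder i (φ k) x) (φ k x * (v i (x i) / w i (x i)))) +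
        (1 + ∑ i, l i) * |φ k x| ^ p)) atTop := by
        refine lintegral_liminf_le fun k => ENNReal.measurable_ofReal.comp (Measurable.add ?_ ?_)
        · refine Finset.measurable_fun_sum _ fun i _ => ?_
          exact (pder_continuous (hφ k).contDiff_one i).measurable.tangentRem hp
            ((hφ k).1.continuous.measurable.mul ((H i).measurable_div i))
        · exact (hcont.measurable.comp (hφ k).1.continuous.measurable).const_mul _
    _ = ENNReal.ofReal (‖G‖ ^ p) := by
        simp only [hnorm]
        refine Tendsto.liminf_eq ?_
        refine (ENNReal.continuous_ofReal.tendsto _).comp ?_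
        exact (Real.continuousAt_rpow_const _ _ (Or.inr hp0.le)).tendsto.comp hlim.norm

theorem sobolevEmb_ae {D : Set (Fin n → ℝ)} (g : W0sub (ENNReal.ofReal p) D) :
    ⇑(SobolevEmb (ENNReal.ofReal p) D g) =ᵐ[volume]
      fun x => (g : Vsp n (ENNReal.ofReal p)) x 0 :=
  (proj0 n (ENNReal.ofReal p)).coeFn_compLpL (g : Vsp n (ENNReal.ofReal p))

theorem lintegral_abs_rpow_eq (hp : 1 < p) {D : Set (Fin n → ℝ)}
    (g : W0sub (ENNReal.ofReal p) D) :
    ∫⁻ x, ENNReal.ofReal (|(g : Vsp n (ENNReal.ofReal p)) x 0| ^ p) =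
      ENNReal.ofReal (‖SobolevEmb (ENNReal.ofReal p) D g‖ ^ p) := by
  rw [← lintegral_norm_rpow_eq hp]
  refine lintegral_congr_ae ?_
  filter_upwards [sobolevEmb_ae g] with x hx
  rw [hx, Real.norm_eq_abs]

theorem aestronglyMeasurable_coord (G : Vsp n (ENNReal.ofReal p)) (j : Fin (n + 1)) :
    AEStronglyMeasurable (fun x => G x j) volume :=
  (PiLp.continuous_apply _ _ j).comp_aestronglyMeasurable (Lp.aestronglyMeasurable G)

theorem lintegral_rem_add_le (hp : 1 < p)
    (H : ∀ i, EigenProfile p (a i) (b i) (w i) (v i) (l i))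
    (g : W0sub (ENNReal.ofReal p) (stripDomain n 0 a b)) :
    (∫⁻ x, ENNReal.ofReal (∑ i : Fin n, tangentRem p ((g : Vsp n (ENNReal.ofReal p)) x i.succ)
        ((g : Vsp n (ENNReal.ofReal p)) x 0 * (v i (x i) / w i (x i))))) +
      ENNReal.ofReal ((1 + ∑ i, l i) *
        ‖SobolevEmb (ENNReal.ofReal p) (stripDomain n 0 a b) g‖ ^ p) ≤
      ENNReal.ofReal (‖g‖ ^ p) := by
  have hl : 0 ≤ 1 + ∑ i, l i :=
    add_nonneg zero_le_one (Finset.sum_nonneg fun i _ => (H i).eigenvalue_nonneg)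
  have h := lintegral_energy_le hp H g.2
  rw [lintegral_congr fun x => ENNReal.ofReal_add
    (Finset.sum_nonneg fun i _ => tangentRem_nonneg hp _ _) (by positivity),
    lintegral_add_right'] at h
  · simp only [ENNReal.ofReal_mul hl] at h ⊢
    rw [lintegral_const_mul' _ _ ENNReal.ofReal_ne_top, lintegral_abs_rpow_eq hp] at h
    exact h
  · exact (((contDiff_abs_rpow hp).continuous.comp_aestronglyMeasurable
      (aestronglyMeasurable_coord _ 0)).aemeasurable.const_mul _).ennreal_ofReal

theorem rayleigh_le (hp : 1 < p) (H : ∀ i, EigenProfile p (a i) (b i) (w i) (v i) (l i))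
    (g : W0sub (ENNReal.ofReal p) (stripDomain n 0 a b)) :
    (1 + ∑ i, l i) * ‖SobolevEmb (ENNReal.ofReal p) (stripDomain n 0 a b) g‖ ^ p ≤ ‖g‖ ^ p :=
  (ENNReal.ofReal_le_ofReal_iff (by positivity)).1 (le_add_self.trans (lintegral_rem_add_le hp H g))

theorem ae_eq_of_rayleigh_eq (hp : 1 < p)
    (H : ∀ i, EigenProfile p (a i) (b i) (w i) (v i) (l i))
    (g : W0sub (ENNReal.ofReal p) (stripDomain n 0 a b))
    (hg : (1 + ∑ i, l i) * ‖SobolevEmb (ENNReal.ofReal p) (stripDomain n 0 a b) g‖ ^ p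
      = ‖g‖ ^ p) :
    ∀ᵐ x, ∀ i : Fin n, (g : Vsp n (ENNReal.ofReal p)) x i.succ =
      (g : Vsp n (ENNReal.ofReal p)) x 0 * (v i (x i) / w i (x i)) := by
  have h := lintegral_rem_add_le hp H g
  rw [hg] at h
  have h0 := le_antisymm (ENNReal.le_of_add_le_add_right ENNReal.ofReal_ne_top
    (h.trans_eq (zero_add _).symm)) zero_le
  rw [lintegral_eq_zero_iff'] at h0
  · filter_upwards [h0] with x hx i
    by_contra hne
    have h1 := tangentRem_pos hp hne
    have h2 := Finset.single_le_sum (f := fun i : Fin n =>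
      tangentRem p ((g : Vsp n (ENNReal.ofReal p)) x i.succ)
        ((g : Vsp n (ENNReal.ofReal p)) x 0 * (v i (x i) / w i (x i))))
      (fun i _ => tangentRem_nonneg hp _ _) (Finset.mem_univ i)
    have h3 := ENNReal.ofReal_eq_zero.1 hx
    linarith
  · refine AEMeasurable.ennreal_ofReal (Finset.aemeasurable_fun_sum _ fun i _ => ?_)
    have h1 := (aestronglyMeasurable_coord (g : Vsp n (ENNReal.ofReal p)) i.succ).aemeasurable
    have h2 := (aestronglyMeasurable_coord (g : Vsp n (ENNReal.ofReal p)) 0).aemeasurable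
    exact h1.tangentRem hp (h2.mul ((H i).measurable_div i).aemeasurable)

end Rectangle

section GroundState

variable {n : ℕ} {p : ℝ} {a b : Fin n → ℝ} {w v : Fin n → ℝ → ℝ} {l : Fin n → ℝ}

theorem EigenProfile.nonneg {a b : ℝ} {w v : ℝ → ℝ} {l : ℝ} (H : EigenProfile p a b w v l)
    (t : ℝ) : 0 ≤ w t := by
  by_cases ht : t ∈ Ioo a b
  · exact (H.pos t ht).le
  · exact (H.eq_zero t ht).ge

/-- The product function and its gradient (as computed inside the rectangle). -/
noncomputable def groundJet (P : ℝ≥0∞) (w v : Fin n → ℝ → ℝ) (x : Fin n → ℝ) :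
    PiLp P (fun _ : Fin (n + 1) => ℝ) :=
  WithLp.toLp P (Fin.cons (∏ j, w j (x j)) fun i => (∏ j, w j (x j)) * (v i (x i) / w i (x i)))

theorem groundJet_zero (P : ℝ≥0∞) (x : Fin n → ℝ) : groundJet P w v x 0 = ∏ j, w j (x j) := rfl

theorem groundJet_succ (P : ℝ≥0∞) (x : Fin n → ℝ) (i : Fin n) :
    groundJet P w v x i.succ = (∏ j, w j (x j)) * (v i (x i) / w i (x i)) := rfl

theorem continuous_prod_profile (H : ∀ i, EigenProfile p (a i) (b i) (w i) (v i) (l i)) :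
    Continuous fun x : Fin n → ℝ => ∏ j, w j (x j) :=
  continuous_finsetProd _ fun j _ => (H j).continuous_fun.comp (continuous_apply j)

theorem prod_profile_nonneg (H : ∀ i, EigenProfile p (a i) (b i) (w i) (v i) (l i))
    (x : Fin n → ℝ) : 0 ≤ ∏ j, w j (x j) :=
  Finset.prod_nonneg fun j _ => (H j).nonneg _

theorem prod_profile_pos (H : ∀ i, EigenProfile p (a i) (b i) (w i) (v i) (l i))
    {x : Fin n → ℝ} (hx : x ∈ stripDomain n 0 a b) : 0 < ∏ j, w j (x j) :=
  Finset.prod_pos fun j _ => (H j).pos _ (mem_stripDomain_zero.1 hx j)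

theorem prod_profile_eq_zero (H : ∀ i, EigenProfile p (a i) (b i) (w i) (v i) (l i))
    {x : Fin n → ℝ} (hx : x ∉ stripDomain n 0 a b) : ∏ j, w j (x j) = 0 := by
  rw [mem_stripDomain_zero, not_forall] at hx
  obtain ⟨j, hj⟩ := hx
  exact Finset.prod_eq_zero (Finset.mem_univ j) ((H j).eq_zero _ hj)

theorem measurable_groundJet (P : ℝ≥0∞) [Fact (1 ≤ P)]
    (H : ∀ i, EigenProfile p (a i) (b i) (w i) (v i) (l i)) :
    Measurable (groundJet P w v) := by
  refine (PiLp.continuous_toLp P _).measurable.comp (measurable_pi_iff.2 fun j => ?_)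
  refine Fin.cases ?_ (fun i => ?_) j
  · exact (continuous_prod_profile H).measurable
  · exact (continuous_prod_profile H).measurable.mul ((H i).measurable_div i)

theorem EigenProfile.integral_abs_rpow (hp : 1 < p) {a b : ℝ} {w v : ℝ → ℝ} {l : ℝ}
    (H : EigenProfile p a b w v l) : ∫ t in Ioo a b, |w t| ^ p = ∫ t, |w t| ^ p :=
  setIntegral_eq_integral_of_forall_compl_eq_zero fun t ht => by
    rw [H.eq_zero t ht, abs_zero, Real.zero_rpow (by linarith)]

theorem integrable_indicator_of_continuous {a b : ℝ} {f : ℝ → ℝ} (hf : Continuous f) :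
    Integrable ((Ioo a b).indicator f) :=
  ((hf.integrableOn_Icc (a := a) (b := b)).mono_set Ioo_subset_Icc_self).integrable_indicator
    measurableSet_Ioo

theorem EigenProfile.integrable_abs_rpow (hp : 1 < p) {a b : ℝ} {w v : ℝ → ℝ} {l : ℝ}
    (H : EigenProfile p a b w v l) : Integrable fun t => |w t| ^ p := by
  refine (integrable_indicator_of_continuous (a := a) (b := b)
    ((contDiff_abs_rpow hp).continuous.comp H.continuous_fun)).congr (Eventually.of_forall fun t => ?_)
  by_cases ht : t ∈ Ioo a b
  · simp [ht]
  · simp [ht, H.eq_zero t ht, Real.zero_rpow (by linarith : p ≠ 0)]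

theorem integrable_prod_profile_rpow (hp : 1 < p)
    (H : ∀ i, EigenProfile p (a i) (b i) (w i) (v i) (l i)) :
    Integrable fun x : Fin n → ℝ => |∏ j, w j (x j)| ^ p := by
  have h : Integrable fun x : Fin n → ℝ => ∏ j, |w j (x j)| ^ p :=
    Integrable.fintype_prod_dep (μ := fun _ => volume) fun j => (H j).integrable_abs_rpow hp
  refine h.congr (Eventually.of_forall fun x => ?_)
  simp only [Finset.abs_prod]
  exact (Real.finsetProd_rpow _ _ (fun j _ => abs_nonneg _) _)

theorem integral_prod_profile_grad_rpow (hp : 1 < p)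
    (H : ∀ i, EigenProfile p (a i) (b i) (w i) (v i) (l i)) (i : Fin n) :
    Integrable (fun x : Fin n → ℝ => |(∏ j, w j (x j)) * (v i (x i) / w i (x i))| ^ p) ∧
      ∫ x : Fin n → ℝ, |(∏ j, w j (x j)) * (v i (x i) / w i (x i))| ^ p =
        l i * ∫ x : Fin n → ℝ, |∏ j, w j (x j)| ^ p := by
  classical
  have hp0 : p ≠ 0 := by linarith
  set g : Fin n → ℝ → ℝ := fun j t =>
    if j = i then (Ioo (a i) (b i)).indicator (fun t => |v i t| ^ p) t else |w j t| ^ p with hg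
  have hcont := (contDiff_abs_rpow hp).continuous
  have hgi : ∀ j, Integrable (g j) := by
    intro j
    by_cases hj : j = i
    · simp only [hg, hj, if_true]
      exact integrable_indicator_of_continuous (hcont.comp (H i).continuous_der)
    · simp only [hg, hj, if_false]
      exact (H j).integrable_abs_rpow hp
  have herase : ∀ x : Fin n → ℝ, ∏ j ∈ Finset.univ.erase i, g j (x j) =
      ∏ j ∈ Finset.univ.erase i, |w j (x j)| ^ p := fun x =>
    Finset.prod_congr rfl fun j hj => by simp [hg, (Finset.mem_erase.1 hj).1]
  have heq : (fun x : Fin n → ℝ => |(∏ j, w j (x j)) * (v i (x i) / w i (x i))| ^ p) =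
      fun x => ∏ j, g j (x j) := by
    funext x
    rw [← Finset.mul_prod_erase _ (fun j => g j (x j)) (Finset.mem_univ i), herase,
      ← Finset.mul_prod_erase _ (fun j => w j (x j)) (Finset.mem_univ i)]
    by_cases hx : x i ∈ Ioo (a i) (b i)
    · have hw := ((H i).pos _ hx).ne'
      have e : w i (x i) * (∏ j ∈ Finset.univ.erase i, w j (x j)) * (v i (x i) / w i (x i)) =
          v i (x i) * ∏ j ∈ Finset.univ.erase i, w j (x j) := by
        field_simp
      simp only [hg, if_true, hx, indicator_of_mem]
      rw [e, abs_mul, Finset.abs_prod, Real.mul_rpow (abs_nonneg _)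
        (Finset.prod_nonneg fun j _ => abs_nonneg _),
        ← Real.finsetProd_rpow _ _ (fun j _ => abs_nonneg _)]
    · simp [hg, hx, (H i).eq_zero _ hx, Real.zero_rpow hp0]
  have hU : (fun x : Fin n → ℝ => |∏ j, w j (x j)| ^ p) = fun x => ∏ j, |w j (x j)| ^ p := by
    funext x
    rw [Finset.abs_prod, Real.finsetProd_rpow _ _ fun j _ => abs_nonneg _]
  rw [heq, hU]
  refine ⟨Integrable.fintype_prod_dep (μ := fun _ => volume) hgi, ?_⟩
  rw [integral_fintype_prod_volume_eq_prod g,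
    integral_fintype_prod_volume_eq_prod fun j t => |w j t| ^ p,
    ← Finset.mul_prod_erase _ _ (Finset.mem_univ i),
    ← Finset.mul_prod_erase _ (fun j => ∫ t, |w j t| ^ p) (Finset.mem_univ i), ← mul_assoc]
  congr 1
  · simp only [hg, if_true]
    rw [integral_indicator measurableSet_Ioo, (H i).integral_eq, (H i).integral_abs_rpow hp]
  · exact Finset.prod_congr rfl fun j hj => by simp [hg, (Finset.mem_erase.1 hj).1]

theorem norm_groundJet_rpow (hp : 1 < p) (x : Fin n → ℝ) :
    ‖groundJet (ENNReal.ofReal p) w v x‖ ^ p = |∏ j, w j (x j)| ^ p +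
      ∑ i, |(∏ j, w j (x j)) * (v i (x i) / w i (x i))| ^ p := by
  rw [piLp_norm_rpow hp, Fin.sum_univ_succ]
  rfl

theorem integral_norm_groundJet_rpow (hp : 1 < p)
    (H : ∀ i, EigenProfile p (a i) (b i) (w i) (v i) (l i)) :
    Integrable (fun x => ‖groundJet (ENNReal.ofReal p) w v x‖ ^ p) ∧
      ∫ x, ‖groundJet (ENNReal.ofReal p) w v x‖ ^ p =
        (1 + ∑ i, l i) * ∫ x : Fin n → ℝ, |∏ j, w j (x j)| ^ p := by
  have h1 := integrable_prod_profile_rpow hp H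
  have h2 := fun i => integral_prod_profile_grad_rpow hp H i
  simp only [norm_groundJet_rpow hp]
  refine ⟨h1.add (integrable_finsetSum _ fun i _ => (h2 i).1), ?_⟩
  rw [integral_add h1 (integrable_finsetSum _ fun i _ => (h2 i).1),
    integral_finsetSum _ fun i _ => (h2 i).1, Finset.sum_congr rfl fun i _ => (h2 i).2,
    ← Finset.sum_mul]
  ring

theorem memLp_groundJet (hp : 1 < p) [Fact (1 ≤ ENNReal.ofReal p)]
    (H : ∀ i, EigenProfile p (a i) (b i) (w i) (v i) (l i)) :
    MemLp (groundJet (ENNReal.ofReal p) w v) (ENNReal.ofReal p) volume := by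
  have hp0 : 0 < p := by linarith
  rw [← integrable_norm_rpow_iff (measurable_groundJet _ H).aestronglyMeasurable
    (by simpa using hp0) ENNReal.ofReal_ne_top, ENNReal.toReal_ofReal hp0.le]
  exact (integral_norm_groundJet_rpow hp H).1

theorem rayleigh_eq_of_ae_eq (hp : 1 < p) [Fact (1 ≤ ENNReal.ofReal p)]
    (H : ∀ i, EigenProfile p (a i) (b i) (w i) (v i) (l i)) {D : Set (Fin n → ℝ)}
    {f : W0sub (ENNReal.ofReal p) D}
    (hf : (f : Vsp n (ENNReal.ofReal p)) =ᵐ[volume] groundJet (ENNReal.ofReal p) w v) :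
    (1 + ∑ i, l i) * ‖SobolevEmb (ENNReal.ofReal p) D f‖ ^ p = ‖f‖ ^ p := by
  have hl : 0 ≤ 1 + ∑ i, l i :=
    add_nonneg zero_le_one (Finset.sum_nonneg fun i _ => (H i).eigenvalue_nonneg)
  have h := integral_norm_groundJet_rpow hp H
  have h1 : ENNReal.ofReal (‖f‖ ^ p) =
      ENNReal.ofReal (∫ x, ‖groundJet (ENNReal.ofReal p) w v x‖ ^ p) := by
    rw [ofReal_integral_eq_lintegral_ofReal h.1 (Eventually.of_forall fun x => by positivity),
      show ‖f‖ = ‖(f : Vsp n (ENNReal.ofReal p))‖ from rfl, ← lintegral_norm_rpow_eq hp]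
    refine lintegral_congr_ae ?_
    filter_upwards [hf] with x hx
    rw [hx]
  have h2 : ENNReal.ofReal (‖SobolevEmb (ENNReal.ofReal p) D f‖ ^ p) =
      ENNReal.ofReal (∫ x : Fin n → ℝ, |∏ j, w j (x j)| ^ p) := by
    rw [ofReal_integral_eq_lintegral_ofReal (integrable_prod_profile_rpow hp H)
      (Eventually.of_forall fun x => by positivity), ← lintegral_abs_rpow_eq hp]
    refine lintegral_congr_ae ?_
    filter_upwards [hf] with x hx
    rw [hx, groundJet_zero]
  rw [ENNReal.ofReal_eq_ofReal_iff (by positivity) (integral_nonneg fun x => by positivity)] at h1 h2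
  rw [h1, h2, h.2]

end GroundState

/-- Dominated convergence in `L^p`. -/
theorem tendsto_Lp_of_dominated {α E : Type*} [MeasurableSpace α] [NormedAddCommGroup E]
    {μ : Measure α} {p : ℝ} (hp : 1 < p) [Fact (1 ≤ ENNReal.ofReal p)] {F : ℕ → Lp E (ENNReal.ofReal p) μ}
    {G : Lp E (ENNReal.ofReal p) μ} {B : α → ℝ} (hB : MemLp B (ENNReal.ofReal p) μ)
    (hbound : ∀ k, ∀ᵐ x ∂μ, ‖F k x‖ ≤ B x)
    (hlim : ∀ᵐ x ∂μ, Tendsto (fun k => F k x) atTop (𝓝 (G x))) : Tendsto F atTop (𝓝 G) := by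
  have hp0 : 0 < p := by linarith
  have hP : (ENNReal.ofReal p).toReal = p := ENNReal.toReal_ofReal hp0.le
  have hG : ∀ᵐ x ∂μ, ‖G x‖ ≤ B x := by
    filter_upwards [hlim, ae_all_iff.2 hbound] with x h1 h2
    exact le_of_tendsto h1.norm (Eventually.of_forall h2)
  have hBi : Integrable (fun x => ‖2 * B x‖ ^ p) μ := by
    have := (hB.const_mul 2).integrable_norm_rpow (by simpa using hp0) ENNReal.ofReal_ne_top
    rwa [hP] at this
  have key : Tendsto (fun k => ∫⁻ x, ENNReal.ofReal (‖(F k - G) x‖ ^ p) ∂μ) atTop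
      (𝓝 (∫⁻ _, 0 ∂μ)) := by
    refine tendsto_lintegral_of_dominated_convergence' (fun x => ENNReal.ofReal (‖2 * B x‖ ^ p))
      (fun k => ?_) (fun k => ?_) ?_ ?_
    · exact ((Lp.aestronglyMeasurable (F k - G)).norm.aemeasurable.pow_const p).ennreal_ofReal
    · filter_upwards [hbound k, hG, Lp.coeFn_sub (F k) G] with x h1 h2 h3
      refine ENNReal.ofReal_le_ofReal (Real.rpow_le_rpow (norm_nonneg _) ?_ hp0.le)
      rw [h3, Pi.sub_apply]
      refine (norm_sub_le _ _).trans (le_trans ?_ (le_abs_self _))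
      linarith
    · exact hBi.lintegral_lt_top.ne
    · filter_upwards [hlim, ae_all_iff.2 fun k => Lp.coeFn_sub (F k) G] with x h1 h2
      simp only [h2, Pi.sub_apply]
      have h3 : Tendsto (fun k => ‖F k x - G x‖ ^ p) atTop (𝓝 0) := by
        have := (tendsto_iff_norm_sub_tendsto_zero.1 h1).rpow_const (p := p) (Or.inr hp0.le)
        rwa [Real.zero_rpow hp0.ne'] at this
      simpa using ENNReal.tendsto_ofReal h3
  simp only [lintegral_norm_rpow_eq hp, lintegral_zero] at key
  rw [tendsto_iff_norm_sub_tendsto_zero]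
  have h4 := ((ENNReal.tendsto_toReal ENNReal.zero_ne_top).comp key).rpow_const (p := p⁻¹)
    (Or.inr (by positivity))
  simp only [ENNReal.toReal_zero, Real.zero_rpow (inv_ne_zero hp0.ne')] at h4
  refine h4.congr fun k => ?_
  rw [Function.comp_apply, ENNReal.toReal_ofReal (by positivity), ← Real.rpow_mul (norm_nonneg _),
    mul_inv_cancel₀ hp0.ne', Real.rpow_one]

section Mollify

open scoped Convolution

variable {n : ℕ} {p : ℝ} {D : Set (Fin n → ℝ)}

/-- A sequence of bump functions at the origin whose supports shrink to the origin. -/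
noncomputable def shrinkingBump (n : ℕ) (δ : ℝ) (hδ : 0 < δ) (k : ℕ) :
    ContDiffBump (0 : Fin n → ℝ) where
  rIn := δ / (k + 1) / 2
  rOut := δ / (k + 1)
  rIn_pos := by positivity
  rIn_lt_rOut := half_lt_self (by positivity)

theorem shrinkingBump_rOut (n : ℕ) {δ : ℝ} (hδ : 0 < δ) (k : ℕ) :
    (shrinkingBump n δ hδ k).rOut = δ / (k + 1) := rfl

theorem shrinkingBump_rOut_le (n : ℕ) {δ : ℝ} (hδ : 0 < δ) (k : ℕ) :
    (shrinkingBump n δ hδ k).rOut ≤ δ := by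
  rw [shrinkingBump_rOut]
  exact div_le_self hδ.le (by linarith [(Nat.cast_nonneg k : (0 : ℝ) ≤ k)])

theorem tendsto_shrinkingBump_rOut (n : ℕ) {δ : ℝ} (hδ : 0 < δ) :
    Tendsto (fun k => (shrinkingBump n δ hδ k).rOut) atTop (𝓝 0) := by
  simp only [shrinkingBump_rOut]
  have := (tendsto_one_div_add_atTop_nhds_zero_nat (𝕜 := ℝ)).const_mul δ
  simpa [div_eq_mul_inv] using this

theorem piLp_norm_le_of_coord_le (hp : 1 < p) {m : ℕ}
    {y : PiLp (ENNReal.ofReal p) (fun _ : Fin m => ℝ)} {M : ℝ} (hy : ∀ i, |y i| ≤ M) :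
    ‖y‖ ≤ (m * M ^ p) ^ p⁻¹ := by
  have hp0 : 0 < p := by linarith
  have hnn : 0 ≤ ‖y‖ := by
    have : Fact (1 ≤ ENNReal.ofReal p) := ⟨ENNReal.one_le_ofReal.mpr hp.le⟩
    exact norm_nonneg y
  rw [Real.le_rpow_inv_iff_of_pos hnn _ hp0, piLp_norm_rpow hp]
  · calc ∑ i, |y i| ^ p ≤ ∑ _i : Fin m, M ^ p :=
          Finset.sum_le_sum fun i _ => Real.rpow_le_rpow (abs_nonneg _) (hy i) hp0.le
      _ = m * M ^ p := by simp
  · rcases Nat.eq_zero_or_pos m with rfl | hm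
    · simp
    · have : 0 ≤ M := (abs_nonneg _).trans (hy ⟨0, hm⟩)
      positivity

/-- Mollification of a function by a normalized bump function. -/
noncomputable def mollify (φ : ContDiffBump (0 : Fin n → ℝ)) (u : (Fin n → ℝ) → ℝ) :
    (Fin n → ℝ) → ℝ :=
  φ.normed volume ⋆[ContinuousLinearMap.lsmul ℝ ℝ, volume] u

theorem contDiff_mollify (φ : ContDiffBump (0 : Fin n → ℝ)) {u : (Fin n → ℝ) → ℝ}
    (hu : LocallyIntegrable u) : ContDiff ℝ (⊤ : ℕ∞) (mollify φ u) :=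
  φ.hasCompactSupport_normed.contDiff_convolution_left _ φ.contDiff_normed hu

theorem tsupport_mollify_subset (φ : ContDiffBump (0 : Fin n → ℝ)) {u : (Fin n → ℝ) → ℝ} {δ : ℝ}
    (hφ : φ.rOut ≤ δ) : tsupport (mollify φ u) ⊆ Metric.cthickening δ (tsupport u) := by
  refine closure_minimal ?_ Metric.isClosed_cthickening
  refine (support_convolution_subset_swap _).trans ?_
  rintro _ ⟨y, hy, z, hz, rfl⟩
  rw [φ.support_normed_eq] at hz
  refine Metric.mem_cthickening_of_dist_le _ y _ _ (subset_tsupport _ hy) ?_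
  have : dist z 0 ≤ δ := (Metric.mem_ball.1 hz).le.trans hφ
  simpa [dist_eq_norm] using this

theorem pder_mollify (φ : ContDiffBump (0 : Fin n → ℝ)) {u : (Fin n → ℝ) → ℝ}
    (hu : ContDiff ℝ 1 u) (hc : HasCompactSupport u) (i : Fin n) :
    pder i (mollify φ u) = mollify φ (pder i u) := by
  funext x
  have hφ : LocallyIntegrable (φ.normed volume) volume :=
    (φ.continuous_normed).locallyIntegrable
  have h := hc.hasFDerivAt_convolution_right (ContinuousLinearMap.lsmul ℝ ℝ) hφ hu x
  rw [pder, mollify, h.fderiv, convolution_precompR_apply _ hφ (hc.fderiv ℝ)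
    (hu.continuous_fderiv one_ne_zero)]
  rfl

theorem abs_mollify_le (φ : ContDiffBump (0 : Fin n → ℝ)) {u : (Fin n → ℝ) → ℝ}
    (hu : Continuous u) {M : ℝ} (hM : ∀ x, |u x| ≤ M) (x : Fin n → ℝ) :
    |mollify φ u x| ≤ 3 * M := by
  have h := φ.dist_normed_convolution_le (μ := volume) (x₀ := x) (ε := 2 * M)
    hu.aestronglyMeasurable fun y _ => by
      rw [Real.dist_eq]
      have := abs_sub (u y) (u x)
      linarith [hM x, hM y]
  rw [Real.dist_eq] at h
  have h2 := abs_sub_abs_le_abs_sub (mollify φ u x) (u x)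
  have h3 : |mollify φ u x - u x| ≤ 2 * M := h
  linarith [hM x]

theorem tendsto_mollify {u : (Fin n → ℝ) → ℝ} (hu : Continuous u) {δ : ℝ} (hδ : 0 < δ)
    (x : Fin n → ℝ) :
    Tendsto (fun k => mollify (shrinkingBump n δ hδ k) u x) atTop (𝓝 (u x)) :=
  ContDiffBump.convolution_tendsto_right_of_continuous (tendsto_shrinkingBump_rOut n hδ) hu x

variable [Fact (1 ≤ ENNReal.ofReal p)]

theorem mem_W0sub_of_tendsto {P : ℝ≥0∞} [Fact (1 ≤ P)] {F : ℕ → Vsp n P} {G : Vsp n P}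
    (hF : ∀ k, F k ∈ W0sub P D) (h : Tendsto F atTop (𝓝 G)) : G ∈ W0sub P D :=
  (Submodule.isClosed_topologicalClosure _).mem_of_tendsto h (Eventually.of_forall hF)

theorem jet_mem_W0sub (hp : 1 < p) (hD : IsOpen D) {u : (Fin n → ℝ) → ℝ} (hu : ContDiff ℝ 1 u)
    (hc : HasCompactSupport u) (hs : tsupport u ⊆ D) :
    (memLp_jet (ENNReal.ofReal p) hu hc).toLp (jet (ENNReal.ofReal p) u) ∈
      W0sub (ENNReal.ofReal p) D := by
  obtain ⟨δ, hδ, hsub⟩ := IsCompact.exists_cthickening_subset_open hc hD hs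
  set K := Metric.cthickening δ (tsupport u) with hK
  have hKc : IsCompact K := hc.isCompact.cthickening
  set U : ℕ → (Fin n → ℝ) → ℝ := fun k => mollify (shrinkingBump n δ hδ k) u with hU
  have hts : ∀ k, tsupport (U k) ⊆ K := fun k =>
    tsupport_mollify_subset _ (shrinkingBump_rOut_le n hδ k)
  have hT : ∀ k, IsTestFun D (U k) := fun k =>
    ⟨contDiff_mollify _ hu.continuous.locallyIntegrable,
      hKc.of_isClosed_subset (isClosed_tsupport _) (hts k), (hts k).trans hsub⟩
  have hpd : ∀ k i, pder i (U k) = mollify (shrinkingBump n δ hδ k) (pder i u) := fun k i =>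
    pder_mollify _ hu hc i
  obtain ⟨M0, hM0⟩ := hc.exists_bound_of_continuous hu.continuous
  choose M1 hM1 using fun i : Fin n =>
    (hasCompactSupport_pder hc i).exists_bound_of_continuous (pder_continuous hu i)
  set M : ℝ := 3 * M0 + ∑ i, 3 * M1 i with hM
  have hM0' : 0 ≤ M0 := (norm_nonneg _).trans (hM0 0)
  have hM1' : ∀ i, 0 ≤ 3 * M1 i := fun i => by linarith [(norm_nonneg _).trans (hM1 i 0)]
  have hcoord : ∀ k x j, |jet (ENNReal.ofReal p) (U k) x j| ≤ M := by
    intro k x j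
    refine Fin.cases ?_ (fun i => ?_) j
    · rw [jet_zero]
      have h1 := abs_mollify_le (shrinkingBump n δ hδ k) hu.continuous hM0 x
      exact h1.trans (le_add_of_nonneg_right (Finset.sum_nonneg fun i _ => hM1' i))
    · rw [jet_succ, hpd]
      have h1 := abs_mollify_le (shrinkingBump n δ hδ k) (pder_continuous hu i) (hM1 i) x
      have h2 := Finset.single_le_sum (f := fun i => 3 * M1 i) (fun i _ => hM1' i)
        (Finset.mem_univ i)
      linarith
  set C : ℝ := (((n + 1 : ℕ) : ℝ) * M ^ p) ^ p⁻¹ with hC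
  have hjU := fun k => (memLp_jet (ENNReal.ofReal p) (hT k).contDiff_one (hT k).2.1)
  refine mem_W0sub_of_tendsto (F := fun k => (hjU k).toLp _) (fun k => ?_) ?_
  · exact Submodule.le_topologicalClosure _
      (Submodule.subset_span ⟨U k, hT k, (hjU k).coeFn_toLp⟩)
  · refine tendsto_Lp_of_dominated hp (B := K.indicator fun _ => C)
      (memLp_indicator_const _ hKc.measurableSet C (Or.inr hKc.measure_lt_top.ne)) (fun k => ?_) ?_
    · filter_upwards [(hjU k).coeFn_toLp] with x hx
      rw [hx]
      by_cases hxK : x ∈ K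
      · rw [indicator_of_mem hxK]
        exact piLp_norm_le_of_coord_le hp (hcoord k x)
      · rw [indicator_of_notMem hxK, jet_eq_zero _ fun h => hxK (hts k h), norm_zero]
    · filter_upwards [ae_all_iff.2 fun k => (hjU k).coeFn_toLp,
        (memLp_jet (ENNReal.ofReal p) hu hc).coeFn_toLp] with x h1 h2
      simp only [h1, h2]
      have h3 : Tendsto (fun k => (jet (ENNReal.ofReal p) (U k) x).ofLp) atTop
          (𝓝 (jet (ENNReal.ofReal p) u x).ofLp) := by
        refine tendsto_pi_nhds.2 fun j => ?_
        refine Fin.cases ?_ (fun i => ?_) j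
        · exact tendsto_mollify hu.continuous hδ x
        · simp only [jet_succ, hpd]
          exact tendsto_mollify (pder_continuous hu i) hδ x
      exact ((PiLp.continuous_toLp _ _).tendsto _).comp h3

end Mollify

section Truncation

/-- A ramp vanishing on `t ≤ 1 / (k + 1)` and converging to `1` on `t > 0`. -/
noncomputable def ramp (k : ℕ) (t : ℝ) : ℝ := max 0 (min 1 ((k + 1) * t - 1))

/-- The primitive of `ramp k` vanishing at the origin. -/
noncomputable def rampInt (k : ℕ) (s : ℝ) : ℝ := ∫ t in (0 : ℝ)..s, ramp k t

theorem continuous_ramp (k : ℕ) : Continuous (ramp k) := by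
  unfold ramp; fun_prop

theorem ramp_mem (k : ℕ) (t : ℝ) : ramp k t ∈ Icc (0 : ℝ) 1 :=
  ⟨le_max_left _ _, max_le zero_le_one (min_le_left _ _)⟩

theorem ramp_eq_zero {k : ℕ} {t : ℝ} (ht : t ≤ 1 / ((k : ℝ) + 1)) : ramp k t = 0 := by
  have hk : (0 : ℝ) < k + 1 := by positivity
  rw [le_div_iff₀ hk] at ht
  exact max_eq_left ((min_le_right _ _).trans (by linarith))

theorem tendsto_ramp {t : ℝ} (ht : 0 < t) : Tendsto (fun k => ramp k t) atTop (𝓝 1) := by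
  refine tendsto_const_nhds.congr' ?_
  obtain ⟨N, hN⟩ := exists_nat_gt (2 / t)
  filter_upwards [eventually_ge_atTop N] with k hk
  have h1 : (N : ℝ) ≤ k := by exact_mod_cast hk
  rw [div_lt_iff₀ ht] at hN
  have h2 : 1 ≤ ((k : ℝ) + 1) * t - 1 := by nlinarith
  rw [ramp, min_eq_left h2, max_eq_right zero_le_one]

theorem hasDerivAt_rampInt (k : ℕ) (s : ℝ) : HasDerivAt (rampInt k) (ramp k s) s :=
  ((continuous_ramp k).integral_hasStrictDerivAt 0 s).hasDerivAt

theorem contDiff_rampInt (k : ℕ) : ContDiff ℝ 1 (rampInt k) := by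
  rw [contDiff_one_iff_deriv]
  refine ⟨fun s => (hasDerivAt_rampInt k s).differentiableAt, ?_⟩
  rw [show deriv (rampInt k) = ramp k from funext fun s => (hasDerivAt_rampInt k s).deriv]
  exact continuous_ramp k

theorem rampInt_eq_zero {k : ℕ} {s : ℝ} (h0 : 0 ≤ s) (hs : s ≤ 1 / ((k : ℝ) + 1)) :
    rampInt k s = 0 := by
  rw [rampInt, intervalIntegral.integral_congr (g := fun _ => 0) fun t ht => ?_]
  · simp
  · rw [uIcc_of_le h0] at ht
    exact ramp_eq_zero (ht.2.trans hs)

theorem abs_rampInt_le (k : ℕ) (s : ℝ) : |rampInt k s| ≤ |s| := by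
  have := intervalIntegral.norm_integral_le_of_norm_le_const (a := 0) (b := s) (f := ramp k)
    (C := 1) fun t _ => by
      rw [Real.norm_eq_abs, abs_of_nonneg (ramp_mem k t).1]; exact (ramp_mem k t).2
  simpa [rampInt] using this

theorem tendsto_rampInt {s : ℝ} (hs : 0 ≤ s) : Tendsto (fun k => rampInt k s) atTop (𝓝 s) := by
  have h := intervalIntegral.tendsto_integral_filter_of_dominated_convergence (μ := volume)
    (a := 0) (b := s) (F := fun k => ramp k) (f := fun _ => (1 : ℝ)) (l := atTop) (fun _ => 1)
    (Eventually.of_forall fun k => (continuous_ramp k).aestronglyMeasurable)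
    (Eventually.of_forall fun k => Eventually.of_forall fun t _ => by
      rw [Real.norm_eq_abs, abs_of_nonneg (ramp_mem k t).1]; exact (ramp_mem k t).2)
    intervalIntegrable_const
    (Eventually.of_forall fun t ht => tendsto_ramp (by rw [uIoc_of_le hs] at ht; exact ht.1))
  simpa [rampInt] using h

variable {n : ℕ} {p : ℝ} {a b : Fin n → ℝ} {w v : Fin n → ℝ → ℝ} {l : Fin n → ℝ}

theorem EigenProfile.contDiffOn {a b : ℝ} {w v : ℝ → ℝ} {l : ℝ} (H : EigenProfile p a b w v l) :
    ContDiffOn ℝ 1 w (Ioo a b) := by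
  rw [contDiffOn_one_iff_derivWithin isOpen_Ioo.uniqueDiffOn]
  refine ⟨fun t ht => (H.hasDerivAt t ht).differentiableAt.differentiableWithinAt, ?_⟩
  refine H.continuous_der.continuousOn.congr fun t ht => ?_
  rw [derivWithin_of_isOpen isOpen_Ioo ht, (H.hasDerivAt t ht).deriv]

theorem contDiffAt_prod_profile (H : ∀ i, EigenProfile p (a i) (b i) (w i) (v i) (l i))
    {x : Fin n → ℝ} (hx : x ∈ stripDomain n 0 a b) :
    ContDiffAt ℝ 1 (fun x : Fin n → ℝ => ∏ j, w j (x j)) x := by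
  refine contDiffAt_prod fun j _ => ?_
  have h1 : ContDiffAt ℝ 1 (w j) (x j) :=
    (H j).contDiffOn.contDiffAt (isOpen_Ioo.mem_nhds (mem_stripDomain_zero.1 hx j))
  exact h1.comp x (contDiff_apply ℝ ℝ j).contDiffAt

theorem pder_prod_profile (H : ∀ i, EigenProfile p (a i) (b i) (w i) (v i) (l i))
    {x : Fin n → ℝ} (hx : x ∈ stripDomain n 0 a b) (i : Fin n) :
    pder i (fun x : Fin n → ℝ => ∏ j, w j (x j)) x = (∏ j, w j (x j)) * (v i (x i) / w i (x i)) := by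
  have hxi := mem_stripDomain_zero.1 hx i
  rw [pder, ← ((contDiffAt_prod_profile H hx).differentiableAt one_ne_zero).lineDeriv_eq_fderiv,
    lineDeriv]
  have hpt : ∀ t : ℝ, ∏ j, w j ((x + t • (Pi.single i (1 : ℝ) : Fin n → ℝ)) j) =
      w i (x i + t) * ∏ j ∈ Finset.univ.erase i, w j (x j) := by
    intro t
    rw [← Finset.mul_prod_erase _ _ (Finset.mem_univ i)]
    congr 1
    · simp
    · refine Finset.prod_congr rfl fun j hj => ?_
      simp [(Finset.mem_erase.1 hj).1]
  simp only [hpt]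
  have h' : HasDerivAt (fun t : ℝ => x i + t) 1 0 := by
    simpa using (hasDerivAt_id (0 : ℝ)).const_add (x i)
  have h1 : HasDerivAt (fun t => w i (x i + t)) (v i (x i)) 0 := by
    have := HasDerivAt.comp (0 : ℝ) (by simpa using (H i).hasDerivAt _ hxi) h'
    simpa [Function.comp_def] using this
  rw [(h1.mul_const _).deriv, ← Finset.mul_prod_erase _ (fun j => w j (x j)) (Finset.mem_univ i)]
  have hw := ((H i).pos _ hxi).ne'
  field_simp

theorem tsupport_rampInt_subset (H : ∀ i, EigenProfile p (a i) (b i) (w i) (v i) (l i)) (k : ℕ) :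
    tsupport (fun x : Fin n → ℝ => rampInt k (∏ j, w j (x j))) ⊆
      {x | 1 / ((k : ℝ) + 1) ≤ ∏ j, w j (x j)} := by
  refine closure_minimal (fun x hx => ?_) (isClosed_le continuous_const (continuous_prod_profile H))
  by_contra h
  exact hx (rampInt_eq_zero (prod_profile_nonneg H x) (not_le.1 h).le)

theorem tsupport_rampInt_subset_stripDomain
    (H : ∀ i, EigenProfile p (a i) (b i) (w i) (v i) (l i)) (k : ℕ) :
    tsupport (fun x : Fin n → ℝ => rampInt k (∏ j, w j (x j))) ⊆ stripDomain n 0 a b := by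
  refine (tsupport_rampInt_subset H k).trans fun x hx => ?_
  by_contra h
  have h1 : 1 / ((k : ℝ) + 1) ≤ ∏ j, w j (x j) := hx
  rw [prod_profile_eq_zero H h] at h1
  have : (0 : ℝ) < 1 / ((k : ℝ) + 1) := by positivity
  linarith

theorem hasCompactSupport_rampInt (H : ∀ i, EigenProfile p (a i) (b i) (w i) (v i) (l i)) (k : ℕ) :
    HasCompactSupport (fun x : Fin n → ℝ => rampInt k (∏ j, w j (x j))) := by
  refine (isCompact_univ_pi fun j => isCompact_Icc (a := a j) (b := b j)).of_isClosed_subset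
    (isClosed_tsupport _) ?_
  refine (tsupport_rampInt_subset_stripDomain H k).trans fun x hx j _ => ?_
  exact Ioo_subset_Icc_self (mem_stripDomain_zero.1 hx j)

theorem contDiff_rampInt_prod (H : ∀ i, EigenProfile p (a i) (b i) (w i) (v i) (l i)) (k : ℕ) :
    ContDiff ℝ 1 (fun x : Fin n → ℝ => rampInt k (∏ j, w j (x j))) := by
  rw [contDiff_iff_contDiffAt]
  intro x
  by_cases hx : x ∈ tsupport (fun x : Fin n → ℝ => rampInt k (∏ j, w j (x j)))
  · exact (contDiff_rampInt k).contDiffAt.comp x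
      (contDiffAt_prod_profile H (tsupport_rampInt_subset_stripDomain H k hx))
  · exact contDiffAt_const.congr_of_eventuallyEq (notMem_tsupport_iff_eventuallyEq.1 hx)

theorem pder_rampInt_prod (H : ∀ i, EigenProfile p (a i) (b i) (w i) (v i) (l i)) (k : ℕ)
    (i : Fin n) (x : Fin n → ℝ) :
    pder i (fun x : Fin n → ℝ => rampInt k (∏ j, w j (x j))) x =
      ramp k (∏ j, w j (x j)) * ((∏ j, w j (x j)) * (v i (x i) / w i (x i))) := by
  by_cases hx : x ∈ stripDomain n 0 a b
  · have h := (hasDerivAt_rampInt k (∏ j, w j (x j))).comp_hasFDerivAt x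
      ((contDiffAt_prod_profile H hx).differentiableAt one_ne_zero).hasFDerivAt
    rw [pder, show fderiv ℝ (fun x : Fin n → ℝ => rampInt k (∏ j, w j (x j))) x = _ from h.fderiv,
      ← pder_prod_profile H hx i]
    simp [pder]
  · rw [pder_eq_zero i fun h => hx (tsupport_rampInt_subset_stripDomain H k h),
      prod_profile_eq_zero H hx]
    simp

theorem piLp_norm_le_norm (hp : 1 < p) {m : ℕ}
    {y z : PiLp (ENNReal.ofReal p) (fun _ : Fin m => ℝ)} (h : ∀ i, |y i| ≤ |z i|) :
    ‖y‖ ≤ ‖z‖ := by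
  have : Fact (1 ≤ ENNReal.ofReal p) := ⟨ENNReal.one_le_ofReal.mpr hp.le⟩
  have hp0 : 0 < p := by linarith
  rw [← Real.rpow_le_rpow_iff (norm_nonneg _) (norm_nonneg _) hp0, piLp_norm_rpow hp,
    piLp_norm_rpow hp]
  exact Finset.sum_le_sum fun i _ => Real.rpow_le_rpow (abs_nonneg _) (h i) hp0.le

theorem groundJet_mem_W0sub (hp : 1 < p) [Fact (1 ≤ ENNReal.ofReal p)]
    (H : ∀ i, EigenProfile p (a i) (b i) (w i) (v i) (l i)) :
    (memLp_groundJet hp H).toLp _ ∈ W0sub (ENNReal.ofReal p) (stripDomain n 0 a b) := by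
  have hj := fun k => memLp_jet (ENNReal.ofReal p) (contDiff_rampInt_prod H k)
    (hasCompactSupport_rampInt H k)
  refine mem_W0sub_of_tendsto (F := fun k => (hj k).toLp _) (fun k => jet_mem_W0sub hp
    isOpen_stripDomain_zero (contDiff_rampInt_prod H k) (hasCompactSupport_rampInt H k)
    (tsupport_rampInt_subset_stripDomain H k)) ?_
  refine tendsto_Lp_of_dominated hp (memLp_groundJet hp H).norm (fun k => ?_) ?_
  · filter_upwards [(hj k).coeFn_toLp] with x hx
    rw [hx]
    refine piLp_norm_le_norm hp fun j => ?_
    refine Fin.cases ?_ (fun i => ?_) j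
    · exact abs_rampInt_le k _
    · rw [jet_succ, pder_rampInt_prod H, groundJet_succ, abs_mul,
        abs_of_nonneg (ramp_mem k _).1]
      exact mul_le_of_le_one_left (abs_nonneg _) (ramp_mem k _).2
  · filter_upwards [ae_all_iff.2 fun k => (hj k).coeFn_toLp,
      (memLp_groundJet hp H).coeFn_toLp] with x h1 h2
    simp only [h1, h2]
    have h3 : Tendsto (fun k => (jet (ENNReal.ofReal p)
        (fun x : Fin n → ℝ => rampInt k (∏ j, w j (x j))) x).ofLp) atTop
          (𝓝 (groundJet (ENNReal.ofReal p) w v x).ofLp) := by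
      refine tendsto_pi_nhds.2 fun j => ?_
      refine Fin.cases ?_ (fun i => ?_) j
      · exact tendsto_rampInt (prod_profile_nonneg H x)
      · simp only [jet_succ, pder_rampInt_prod H, groundJet_succ]
        rcases (prod_profile_nonneg H x).eq_or_lt with h0 | h0
        · simp [← h0]
        · simpa using (tendsto_ramp h0).mul_const _
    exact ((PiLp.continuous_toLp _ _).tendsto _).comp h3

end Truncation

section WeakDerivative

open scoped Convolution

variable {n : ℕ} {D : Set (Fin n → ℝ)}

theorem exists_clm_integral_coord_mul (P : ℝ≥0∞) [Fact (1 ≤ P)] {η : (Fin n → ℝ) → ℝ}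
    (hη : Continuous η) (hc : HasCompactSupport η) (j : Fin (n + 1)) :
    ∃ L : Vsp n P →L[ℝ] ℝ, ∀ F, Integrable (fun x => F x j * η x) ∧ L F = ∫ x, F x j * η x := by
  have h1 : Fact (1 ≤ P.conjExponent) := ⟨by simp [ENNReal.conjExponent]⟩
  have hm : MemLp η P.conjExponent volume := hη.memLp_of_hasCompactSupport hc
  let B : PiLp P (fun _ : Fin (n + 1) => ℝ) →L[ℝ] ℝ →L[ℝ] ℝ :=
    (ContinuousLinearMap.mul ℝ ℝ).comp (PiLp.proj P (fun _ => ℝ) j)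
  refine ⟨(B.lpPairing volume P P.conjExponent).flip (hm.toLp η), fun F => ⟨?_, ?_⟩⟩
  · exact memLp_one_iff_integrable.1 (B.memLp_of_bilin 1 (Lp.memLp F) hm)
  · rw [ContinuousLinearMap.flip_apply, ContinuousLinearMap.lpPairing_eq_integral]
    refine integral_congr_ae ?_
    filter_upwards [hm.coeFn_toLp] with x hx
    rw [hx]; rfl

/-- The gradient components of an element of `W₀^{1,p}` are its weak derivatives. -/
theorem integral_coord_mul_pder (P : ℝ≥0∞) [Fact (1 ≤ P)] {G : Vsp n P} (hG : G ∈ W0sub P D)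
    {η : (Fin n → ℝ) → ℝ} (hη : ContDiff ℝ 1 η) (hc : HasCompactSupport η) (i : Fin n) :
    Integrable (fun x => G x 0 * pder i η x) ∧ Integrable (fun x => G x i.succ * η x) ∧
      ∫ x, G x i.succ * η x = -∫ x, G x 0 * pder i η x := by
  obtain ⟨L, hL⟩ := exists_clm_integral_coord_mul P (pder_continuous hη i)
    (hasCompactSupport_pder hc i) 0
  obtain ⟨M, hM⟩ := exists_clm_integral_coord_mul P hη.continuous hc i.succ
  refine ⟨(hL G).1, (hM G).1, ?_⟩
  obtain ⟨φ, F, hφ, hF, hlim, -⟩ := exists_testFun_seq P hG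
  rw [← (hL G).2, ← (hM G).2]
  refine tendsto_nhds_unique ((M.continuous.tendsto G).comp hlim) ?_
  refine ((L.continuous.tendsto G).comp hlim).neg.congr fun k => ?_
  simp only [Function.comp_apply]
  rw [(hL _).2, (hM _).2]
  have hd := (hφ k).contDiff_one
  have h := (integral_mul_eq_neg_of_hasLineDerivAt hη hc i (g := φ k) (g' := pder i (φ k))
    (fun x _ => hd.continuous.continuousAt) (fun x _ => (pder_continuous hd i).continuousAt)
    (fun x _ => (hd.differentiable one_ne_zero x).hasFDerivAt.hasLineDerivAt _)).2.2
  have e1 : ∫ x, F k x 0 * pder i η x = ∫ x, pder i η x * φ k x := by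
    refine integral_congr_ae ?_
    filter_upwards [hF k] with x hx
    rw [hx, jet_zero, mul_comm]
  have e2 : ∫ x, F k x i.succ * η x = ∫ x, η x * pder i (φ k) x := by
    refine integral_congr_ae ?_
    filter_upwards [hF k] with x hx
    rw [hx, jet_succ, mul_comm]
  rw [e1, e2, h]

theorem pder_mollify_eq_integral (φ : ContDiffBump (0 : Fin n → ℝ)) {u : (Fin n → ℝ) → ℝ}
    (hu : LocallyIntegrable u) (i : Fin n) (x : Fin n → ℝ) :
    pder i (mollify φ u) x = -∫ y, u y * pder i (fun y => φ.normed volume (x - y)) y := by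
  have hφ : ContDiff ℝ 1 (φ.normed volume) := φ.contDiff_normed
  have hc : HasCompactSupport (φ.normed volume) := φ.hasCompactSupport_normed
  have h := hc.hasFDerivAt_convolution_right (ContinuousLinearMap.lsmul ℝ ℝ).flip hu hφ x
  rw [convolution_flip] at h
  rw [pder, mollify, h.fderiv, convolution_precompR_apply _ hu (hc.fderiv ℝ)
    (hφ.continuous_fderiv one_ne_zero), convolution_def, ← integral_neg]
  refine integral_congr_ae (Eventually.of_forall fun y => ?_)
  have h2 : HasFDerivAt (fun y => φ.normed volume (x - y)) _ y :=
    ((hφ.differentiable one_ne_zero (x - y)).hasFDerivAt).comp y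
      ((hasFDerivAt_id y).const_sub x)
  simp [pder, h2.fderiv, mul_comm]

theorem fderiv_eq_zero_of_pder {u : (Fin n → ℝ) → ℝ} {x : Fin n → ℝ}
    (h : ∀ i, pder i u x = 0) : fderiv ℝ u x = 0 := by
  refine ContinuousLinearMap.coe_injective (LinearMap.pi_ext' fun i => LinearMap.ext_ring ?_)
  simpa [pder] using h i

/-- A locally integrable function on a rectangle whose weak gradient vanishes is constant on
slightly smaller rectangles. -/
theorem ae_const_of_weak_grad_eq_zero_shrink {a b : Fin n → ℝ} {h : (Fin n → ℝ) → ℝ} {δ : ℝ}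
    (hδ : 0 < δ)
    (hI : IntegrableOn h (stripDomain n 0 (fun i => a i + δ) (fun i => b i - δ)))
    (hw : ∀ ψ : (Fin n → ℝ) → ℝ, ContDiff ℝ 1 ψ → HasCompactSupport ψ →
      tsupport ψ ⊆ stripDomain n 0 a b → ∀ i, ∫ x, h x * pder i ψ x = 0) :
    ∃ S : Set (Fin n → ℝ), (∀ᵐ x, x ∈ S) ∧
      ∀ x ∈ S ∩ stripDomain n 0 (fun i => a i + 2 * δ) (fun i => b i - 2 * δ),
      ∀ y ∈ S ∩ stripDomain n 0 (fun i => a i + 2 * δ) (fun i => b i - 2 * δ), h x = h y := by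
  set D1 := stripDomain n 0 (fun i => a i + δ) (fun i => b i - δ) with hD1
  set D2 := stripDomain n 0 (fun i => a i + 2 * δ) (fun i => b i - 2 * δ) with hD2
  have hD1m : MeasurableSet D1 := isOpen_stripDomain_zero.measurableSet
  have hu : LocallyIntegrable (D1.indicator h) volume :=
    (hI.integrable_indicator hD1m).locallyIntegrable
  have hD21 : D2 ⊆ D1 := fun x hx => mem_stripDomain_zero.2 fun i => by
    have := mem_stripDomain_zero.1 hx i
    exact ⟨by linarith [this.1], by linarith [this.2]⟩
  set U := fun k => mollify (shrinkingBump n δ hδ k) (D1.indicator h) with hU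
  have hconst : ∀ k, ∀ x ∈ D2, ∀ y ∈ D2, U k x = U k y := by
    intro k x hx y hy
    have hpre : IsPreconnected D2 := by
      rw [hD2, stripDomain_zero_eq_pi]
      exact (convex_pi fun i _ => convex_Ioo _ _).isPreconnected
    refine IsOpen.is_const_of_fderiv_eq_zero (𝕜 := ℝ) isOpen_stripDomain_zero hpre
      (((contDiff_mollify _ hu).differentiable (by simp)).differentiableOn) (fun z hz => ?_) hx hy
    refine fderiv_eq_zero_of_pder fun i => ?_
    set φ := shrinkingBump n δ hδ k with hφ
    set ψ : (Fin n → ℝ) → ℝ := fun y => φ.normed volume (z - y) with hψ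
    have hts : tsupport ψ ⊆ Metric.closedBall z δ := by
      refine closure_minimal (fun t ht => ?_) Metric.isClosed_closedBall
      have h1 : z - t ∈ Function.support (φ.normed volume) := ht
      rw [φ.support_normed_eq, mem_ball_zero_iff] at h1
      rw [Metric.mem_closedBall, dist_comm, dist_eq_norm]
      exact h1.le.trans (shrinkingBump_rOut_le n hδ k)
    have hball : Metric.closedBall z δ ⊆ D1 := fun t ht => mem_stripDomain_zero.2 fun j => by
      have h1 := mem_stripDomain_zero.1 hz j
      have h2 : |t j - z j| ≤ δ := (norm_le_pi_norm (t - z) j).trans (by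
        rwa [Metric.mem_closedBall, dist_eq_norm] at ht)
      rw [abs_le] at h2
      exact ⟨by linarith [h1.1, h2.1], by linarith [h1.2, h2.2]⟩
    have hD1' : D1 ⊆ stripDomain n 0 a b := fun x hx => mem_stripDomain_zero.2 fun i => by
      have := mem_stripDomain_zero.1 hx i
      exact ⟨by linarith [this.1], by linarith [this.2]⟩
    have hψd : ContDiff ℝ 1 ψ := φ.contDiff_normed.comp (contDiff_const.sub contDiff_id)
    rw [pder_mollify_eq_integral _ hu, neg_eq_zero, ← hw ψ hψd
      ((isCompact_closedBall z δ).of_isClosed_subset (isClosed_tsupport _) hts)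
      (hts.trans (hball.trans hD1')) i]
    refine integral_congr_ae (Eventually.of_forall fun t => ?_)
    by_cases ht : t ∈ tsupport ψ
    · simp only [indicator_of_mem (hball (hts ht))]
      rfl
    · have h0 : pder i ψ t = 0 := pder_eq_zero i ht
      simp only [h0, mul_zero]
      exact mul_eq_zero_of_right _ h0
  have hlim := ContDiffBump.ae_convolution_tendsto_right_of_locallyIntegrable (K := 2)
    (tendsto_shrinkingBump_rOut n hδ) (Eventually.of_forall fun k => by
      simp [shrinkingBump, mul_div_cancel₀]) hu
  refine ⟨{x | Tendsto (fun k => U k x) atTop (𝓝 (D1.indicator h x))}, hlim, ?_⟩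
  rintro x ⟨hx, hx2⟩ y ⟨hy, hy2⟩
  have := tendsto_nhds_unique hx (Tendsto.congr (fun k => hconst k y hy2 x hx2) hy)
  rwa [indicator_of_mem (hD21 hx2), indicator_of_mem (hD21 hy2)] at this

theorem ae_const_of_weak_grad_eq_zero {a b : Fin n → ℝ} {h : (Fin n → ℝ) → ℝ}
    (hI : ∀ δ > 0, IntegrableOn h (stripDomain n 0 (fun i => a i + δ) (fun i => b i - δ)))
    (hw : ∀ ψ : (Fin n → ℝ) → ℝ, ContDiff ℝ 1 ψ → HasCompactSupport ψ →
      tsupport ψ ⊆ stripDomain n 0 a b → ∀ i, ∫ x, h x * pder i ψ x = 0) :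
    ∃ c : ℝ, ∀ᵐ x, x ∈ stripDomain n 0 a b → h x = c := by
  have hδ : ∀ m : ℕ, (0 : ℝ) < 1 / (m + 1) := fun m => by positivity
  choose S hS hS2 using fun m : ℕ => ae_const_of_weak_grad_eq_zero_shrink (hδ m) (hI _ (hδ m)) hw
  have hev : ∀ x ∈ stripDomain n 0 a b, ∀ᶠ m : ℕ in atTop,
      x ∈ stripDomain n 0 (fun i => a i + 2 * (1 / ((m : ℝ) + 1)))
        (fun i => b i - 2 * (1 / ((m : ℝ) + 1))) := by
    intro x hx
    simp only [mem_stripDomain_zero]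
    refine eventually_all.2 fun i => ?_
    have h0 := (tendsto_one_div_add_atTop_nhds_zero_nat (𝕜 := ℝ)).const_mul 2
    rw [mul_zero] at h0
    have hxi := mem_stripDomain_zero.1 hx i
    filter_upwards [h0.eventually_lt_const (sub_pos.2 hxi.1),
      h0.eventually_lt_const (sub_pos.2 hxi.2)] with m h1 h2
    exact ⟨by linarith, by linarith⟩
  by_cases hne : ∃ x0 ∈ stripDomain n 0 a b, ∀ m, x0 ∈ S m
  · obtain ⟨x0, hx0, hx0S⟩ := hne
    refine ⟨h x0, ?_⟩
    filter_upwards [ae_all_iff.2 hS] with x hxS hx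
    obtain ⟨m, h1, h2⟩ := ((hev x hx).and (hev x0 hx0)).exists
    exact hS2 m x ⟨hxS m, h1⟩ x0 ⟨hx0S m, h2⟩
  · refine ⟨0, ?_⟩
    filter_upwards [ae_all_iff.2 hS] with x hxS hx
    exact absurd ⟨x, hx, hxS⟩ hne

end WeakDerivative

section Uniqueness

variable {n : ℕ} {p : ℝ} {a b : Fin n → ℝ} {w v : Fin n → ℝ → ℝ} {l : Fin n → ℝ}

theorem integral_div_prod_profile_mul_pder (P : ℝ≥0∞) [Fact (1 ≤ P)]
    (H : ∀ i, EigenProfile p (a i) (b i) (w i) (v i) (l i))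
    {G : Vsp n P} (hG : G ∈ W0sub P (stripDomain n 0 a b))
    (hq : ∀ᵐ x, ∀ i : Fin n, G x i.succ = G x 0 * (v i (x i) / w i (x i)))
    {ψ : (Fin n → ℝ) → ℝ} (hψ : ContDiff ℝ 1 ψ) (hc : HasCompactSupport ψ)
    (hs : tsupport ψ ⊆ stripDomain n 0 a b) (i : Fin n) :
    ∫ x, G x 0 * (∏ j, w j (x j))⁻¹ * pder i ψ x = 0 := by
  set U : (Fin n → ℝ) → ℝ := fun x => ∏ j, w j (x j) with hU
  set η : (Fin n → ℝ) → ℝ := fun x => ψ x * (U x)⁻¹ with hηdef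
  have hts : tsupport η ⊆ tsupport ψ := tsupport_mul_subset_left
  have hUd : ∀ x ∈ tsupport ψ, ContDiffAt ℝ 1 U x := fun x hx =>
    contDiffAt_prod_profile H (hs hx)
  have hU0 : ∀ x ∈ tsupport ψ, U x ≠ 0 := fun x hx => (prod_profile_pos H (hs hx)).ne'
  have hη : ContDiff ℝ 1 η := by
    rw [contDiff_iff_contDiffAt]
    intro x
    by_cases hx : x ∈ tsupport ψ
    · exact hψ.contDiffAt.mul ((hUd x hx).inv (hU0 x hx))
    · refine contDiffAt_const.congr_of_eventuallyEq
        (notMem_tsupport_iff_eventuallyEq.1 fun h => hx (hts h))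
  have hηc : HasCompactSupport η := hc.mul_right
  obtain ⟨h1, h2, h3⟩ := integral_coord_mul_pder P hG hη hηc i
  rw [eq_neg_iff_add_eq_zero, ← integral_add h2 h1] at h3
  rw [← h3]
  refine integral_congr_ae ?_
  filter_upwards [hq] with x hx
  by_cases hxs : x ∈ tsupport ψ
  · have hev : ψ =ᶠ[𝓝 x] fun y => η y * U y := by
      have : ∀ᶠ y in 𝓝 x, y ∈ stripDomain n 0 a b := isOpen_stripDomain_zero.mem_nhds (hs hxs)
      filter_upwards [this] with y hy
      exact (inv_mul_cancel_right₀ (prod_profile_pos H hy).ne' _).symm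
    have hpd : pder i ψ x = pder i η x * U x + η x * (U x * (v i (x i) / w i (x i))) := by
      rw [← pder_prod_profile H (hs hxs) i, pder, hev.fderiv_eq,
        fderiv_fun_mul (hη.differentiable one_ne_zero x)
          ((hUd x hxs).differentiableAt one_ne_zero)]
      simp only [pder, add_apply, smul_apply, smul_eq_mul]
      ring
    have := hU0 x hxs
    have e : G x 0 * (U x)⁻¹ * pder i ψ x =
      G x i.succ * η x + G x 0 * pder i η x := by
      rw [hpd, hx i]
      field_simp
      ring
    exact e
  · rw [pder_eq_zero i hxs, pder_eq_zero i fun h => hxs (hts h),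
      image_eq_zero_of_notMem_tsupport fun h => hxs (hts h)]
    simp

theorem memLp_coord (P : ℝ≥0∞) [Fact (1 ≤ P)] (G : Vsp n P) (j : Fin (n + 1)) :
    MemLp (fun x => G x j) P volume :=
  (Lp.memLp G).mono ((PiLp.continuous_apply _ _ j).comp_aestronglyMeasurable
    (Lp.aestronglyMeasurable G)) (Eventually.of_forall fun _ => PiLp.norm_apply_le _ j)

theorem integrableOn_div_prod_profile (P : ℝ≥0∞) [Fact (1 ≤ P)]
    (H : ∀ i, EigenProfile p (a i) (b i) (w i) (v i) (l i)) (G : Vsp n P) {δ : ℝ} (hδ : 0 < δ) :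
    IntegrableOn (fun x => G x 0 * (∏ j, w j (x j))⁻¹)
      (stripDomain n 0 (fun i => a i + δ) (fun i => b i - δ)) := by
  set K : Set (Fin n → ℝ) := univ.pi fun i => Icc (a i + δ) (b i - δ) with hK
  have hKc : IsCompact K := isCompact_univ_pi fun i => isCompact_Icc
  have hKD : K ⊆ stripDomain n 0 a b := fun x hx => mem_stripDomain_zero.2 fun i => by
    have := hx i (mem_univ i)
    exact ⟨by linarith [this.1], by linarith [this.2]⟩
  have hfin : IsFiniteMeasure (volume.restrict K) := ⟨by simpa using hKc.measure_lt_top⟩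
  have h1 : IntegrableOn (fun x => G x 0) K volume :=
    ((memLp_coord P G 0).restrict K).integrable Fact.out
  have h2 : ContinuousOn (fun x : Fin n → ℝ => (∏ j, w j (x j))⁻¹) K :=
    (continuous_prod_profile H).continuousOn.inv₀ fun x hx => (prod_profile_pos H (hKD hx)).ne'
  refine (h1.mul_continuousOn h2 hKc).mono_set ?_
  rw [stripDomain_zero_eq_pi]
  exact pi_mono fun i _ => Ioo_subset_Icc_self

/-- Elements of `W₀^{1,p}` whose logarithmic gradient is that of the ground state are multiples of
the ground state. -/
theorem exists_ae_eq_smul_groundJet (P : ℝ≥0∞) [Fact (1 ≤ P)]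
    (H : ∀ i, EigenProfile p (a i) (b i) (w i) (v i) (l i))
    {G : Vsp n P} (hG : G ∈ W0sub P (stripDomain n 0 a b))
    (hq : ∀ᵐ x, ∀ i : Fin n, G x i.succ = G x 0 * (v i (x i) / w i (x i))) :
    ∃ c : ℝ, G =ᵐ[volume] fun x => c • groundJet P w v x := by
  obtain ⟨c, hc⟩ := ae_const_of_weak_grad_eq_zero
    (fun δ hδ => integrableOn_div_prod_profile P H G hδ)
    (fun ψ hψ hψc hs i => integral_div_prod_profile_mul_pder P H hG hq hψ hψc hs i)
  refine ⟨c, ?_⟩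
  filter_upwards [hc, hq, ae_eq_zero_of_mem_W0sub P hG] with x h1 h2 h3
  have h0 : G x 0 = c * ∏ j, w j (x j) := by
    by_cases hx : x ∈ stripDomain n 0 a b
    · have := (prod_profile_pos H hx).ne'
      rw [← h1 hx]
      field_simp
    · rw [h3 hx, prod_profile_eq_zero H hx, mul_zero]
      rfl
  ext j
  refine Fin.cases ?_ (fun i => ?_) j
  · rw [h0]; rfl
  · rw [h2 i, h0, PiLp.smul_apply, groundJet_succ, smul_eq_mul, mul_assoc]

theorem volume_stripDomain_zero_ne_zero (hab : ∀ i, a i < b i) :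
    volume (stripDomain n 0 a b) ≠ 0 := by
  refine (isOpen_stripDomain_zero.measure_pos volume ⟨fun i => (a i + b i) / 2, ?_⟩).ne'
  exact mem_stripDomain_zero.2 fun i => ⟨by linarith [hab i], by linarith [hab i]⟩

theorem exists_mem_of_ae {D : Set (Fin n → ℝ)} (hD : volume D ≠ 0) {q : (Fin n → ℝ) → Prop}
    (hq : ∀ᵐ x, q x) : ∃ x ∈ D, q x := by
  by_contra! h
  exact hD (measure_mono_null h hq)

end Uniqueness

theorem norm_div_le_rpow_iff {p A B l : ℝ} (hp : 1 < p) (hA : 0 ≤ A) (hB : 0 < B) (hl : 0 < l) :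
    (l * A ^ p ≤ B ^ p ↔ A / B ≤ l⁻¹ ^ p⁻¹) ∧ (l * A ^ p = B ^ p ↔ A / B = l⁻¹ ^ p⁻¹) := by
  have hp0 : 0 < p := by linarith
  have hBp : 0 < B ^ p := Real.rpow_pos_of_pos hB p
  have hAB : 0 ≤ A / B := by positivity
  refine ⟨?_, ?_⟩
  · rw [Real.le_rpow_inv_iff_of_pos hAB (by positivity) hp0, Real.div_rpow hA hB.le,
      div_le_iff₀ hBp, ← div_eq_inv_mul, le_div_iff₀ hl, mul_comm]
  · rw [Real.eq_rpow_inv hAB (by positivity) hp0.ne', Real.div_rpow hA hB.le,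
      div_eq_iff hBp.ne', ← div_eq_inv_mul, eq_div_iff hl.ne', mul_comm]

/-- On the rectangle `R = ∏_{i=1}^n (aᵢ,bᵢ)`, the norm of the canonical
embedding `W₀^{1,p}(R) ↪ L^p(R)` is attained by the function
`u(x) = ∏ᵢ sin_p(π_p (xᵢ - aᵢ)/(bᵢ - aᵢ))`; moreover this is the unique positive maximizer
up to a positive multiplicative constant. -/
theorem embedding_norm_attained_rectangle
    (n : ℕ) (p : ℝ) (hp : 1 < p)
    (a b : Fin n → ℝ) (hab : ∀ i : Fin n, a i < b i) :
    letI : Fact (1 ≤ ENNReal.ofReal p) := ⟨ENNReal.one_le_ofReal.mpr hp.le⟩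
    ∃ f : W0sub (ENNReal.ofReal p) (stripDomain n 0 a b), f ≠ 0 ∧
      -- `f` is (the element of `W₀^{1,p}(R)` corresponding to) the function `u` above
      (⇑(SobolevEmb (ENNReal.ofReal p) (stripDomain n 0 a b) f) =ᵐ[volume]
        (stripDomain n 0 a b).indicator
          (fun x => ∏ i : Fin n, sinp p (piP p * (x i - a i) / (b i - a i)))) ∧
      -- `f` attains the norm of the embedding
      (∀ g : W0sub (ENNReal.ofReal p) (stripDomain n 0 a b), g ≠ 0 →
        ‖SobolevEmb (ENNReal.ofReal p) (stripDomain n 0 a b) g‖ / ‖g‖ ≤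
          ‖SobolevEmb (ENNReal.ofReal p) (stripDomain n 0 a b) f‖ / ‖f‖) ∧
      -- `f` is the unique positive maximizer, up to a positive multiplicative constant
      (∀ g : W0sub (ENNReal.ofReal p) (stripDomain n 0 a b), g ≠ 0 →
        (∀ᵐ x ∂(volume : Measure (Fin n → ℝ)), x ∈ stripDomain n 0 a b →
          0 < (SobolevEmb (ENNReal.ofReal p) (stripDomain n 0 a b) g : (Fin n → ℝ) → ℝ) x) →
        ‖SobolevEmb (ENNReal.ofReal p) (stripDomain n 0 a b) g‖ / ‖g‖ =
          ‖SobolevEmb (ENNReal.ofReal p) (stripDomain n 0 a b) f‖ / ‖f‖ →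
        ∃ c : ℝ, 0 < c ∧ g = c • f) := by
  choose w v l H hsin using fun i => exists_eigenProfile hp (hab i)
  have hF : Fact (1 ≤ ENNReal.ofReal p) := ⟨ENNReal.one_le_ofReal.mpr hp.le⟩
  have hp0 : 0 < p := by linarith
  have hl : 0 < 1 + ∑ i, l i :=
    add_pos_of_pos_of_nonneg one_pos (Finset.sum_nonneg fun i _ => (H i).eigenvalue_nonneg)
  have hvol := volume_stripDomain_zero_ne_zero hab
  set D := stripDomain n 0 a b with hD
  set f : W0sub (ENNReal.ofReal p) D := ⟨_, groundJet_mem_W0sub hp H⟩ with hf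
  have hfj : (f : Vsp n (ENNReal.ofReal p)) =ᵐ[volume] groundJet (ENNReal.ofReal p) w v :=
    (memLp_groundJet hp H).coeFn_toLp
  have hf0 : f ≠ 0 := by
    intro h0
    rw [h0] at hfj
    have h1 : ((0 : W0sub (ENNReal.ofReal p) D) : Vsp n (ENNReal.ofReal p)) =ᵐ[volume] 0 :=
      Lp.coeFn_zero _ _ _
    obtain ⟨x, hx, h2, h3⟩ := exists_mem_of_ae hvol (hfj.and h1)
    have h4 := congrArg (fun y : PiLp (ENNReal.ofReal p) (fun _ : Fin (n + 1) => ℝ) => y 0)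
      (h2.symm.trans h3)
    exact (prod_profile_pos H hx).ne' h4
  have hrf := ((norm_div_le_rpow_iff hp (norm_nonneg (SobolevEmb (ENNReal.ofReal p) D f))
    (norm_pos_iff.2 hf0) hl).2).1 (rayleigh_eq_of_ae_eq hp H hfj)
  refine ⟨f, hf0, ?_, fun g hg => ?_, fun g hg hpos hgeq => ?_⟩
  · filter_upwards [sobolevEmb_ae f, hfj] with x h1 h2
    rw [h1, h2, groundJet_zero]
    by_cases hx : x ∈ D
    · rw [indicator_of_mem hx]
      exact Finset.prod_congr rfl fun i _ => hsin i _ (mem_stripDomain_zero.1 hx i)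
    · rw [indicator_of_notMem hx, prod_profile_eq_zero H hx]
  · rw [hrf]
    exact ((norm_div_le_rpow_iff hp (norm_nonneg (SobolevEmb (ENNReal.ofReal p) D g))
      (norm_pos_iff.2 hg) hl).1).1 (rayleigh_le hp H g)
  · rw [hrf] at hgeq
    have h1 := ((norm_div_le_rpow_iff hp (norm_nonneg (SobolevEmb (ENNReal.ofReal p) D g))
      (norm_pos_iff.2 hg) hl).2).2 hgeq
    obtain ⟨c, hc⟩ := exists_ae_eq_smul_groundJet (ENNReal.ofReal p) H g.2
      (ae_eq_of_rayleigh_eq hp H g h1)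
    refine ⟨c, ?_, Subtype.ext (Lp.ext ?_)⟩
    · obtain ⟨x, hx, h2, h3, h4⟩ := exists_mem_of_ae hvol (hpos.and ((sobolevEmb_ae g).and hc))
      have h5 := h2 hx
      simp only [h3, h4, PiLp.smul_apply, groundJet_zero, smul_eq_mul] at h5
      exact pos_of_mul_pos_left h5 (prod_profile_pos H hx).le
    · filter_upwards [hc, hfj, Lp.coeFn_smul c (f : Vsp n (ENNReal.ofReal p))] with x h2 h3 h4
      rw [h2, ← h3]
      exact h4.symm
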